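/- In the exterior Dirichlet setting, fix x₀ = R·eₙ ∈ ∂B_R, and for δ ≤ R/2 set Ω_δ = B_δ(x₀) ∩ B_R. Define the linear operators Lw = u^{ij}w_{ij} − (n+2)/(1+|Du|²)·uⁱw_i (where (u^{ij}) is the inverse of the Hessian (u_{ij}) of u = u^R, uⁱ = u_i, and summation over repeated indices is understood) and Tw = w_t − (x_t/R)·w_n for a fixed index t < n. Then there is a constant c independent of R such that: |T(u − u̲)| ≤ c/√R in Ω_δ; |T(u − u̲)(x)| ≤ (c/R²)·|x − x₀|² for x ∈ ∂B_R; and |L(T(u − u̲))| ≤ c + (c/R²)·tr(u^{ij}) in Ω_δ, where tr(u^{ij}) = Σ_i u^{ii}. -/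

import Mathlib

open Metric Set Filter
open scoped Topology RealInnerProductSpace

noncomputable section

abbrev Euc (n : ℕ) : Type := EuclideanSpace ℝ (Fin n)

/-- The Hessian matrix of `u` at `x`, `(u_{ij})`. -/
noncomputable def Hess {n : ℕ} (u : Euc n → ℝ) (x : Euc n) : Matrix (Fin n) (Fin n) ℝ :=
  fun i j => iteratedFDeriv ℝ 2 u x ![EuclideanSpace.single i 1, EuclideanSpace.single j 1]

/-- The Gauß curvature operator `K[u] = det D²u / (1+|Du|²)^((n+2)/2)`. -/
noncomputable def gaussK {n : ℕ} (u : Euc n → ℝ) (x : Euc n) : ℝ :=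
  (Hess u x).det / (1 + ‖fderiv ℝ u x‖ ^ 2) ^ (((n : ℝ) + 2) / 2)

/-- Partial derivative `w_i` relative to a set `S`. -/
noncomputable def pdW {n : ℕ} (S : Set (Euc n)) (w : Euc n → ℝ) (x : Euc n) (i : Fin n) : ℝ :=
  fderivWithin ℝ w S x (EuclideanSpace.single i 1)

/-- The Hessian matrix `(w_{ij})` relative to a set `S`. -/
noncomputable def HessW {n : ℕ} (S : Set (Euc n)) (w : Euc n → ℝ) (x : Euc n) :
    Matrix (Fin n) (Fin n) ℝ :=
  fun i j => iteratedFDerivWithin ℝ 2 w S x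
    ![EuclideanSpace.single i 1, EuclideanSpace.single j 1]

/-- The exterior Dirichlet setting of Finster–Schnürer. -/
structure ExtSetting (n : ℕ) where
  K : Set (Euc n)
  f : Euc n → ℝ → ℝ
  u₀ : Euc n → ℝ
  ul : Euc n → ℝ
  R₀ : ℝ
  hn : 2 ≤ n
  hR₀ : 0 < R₀
  hKne : K.Nonempty
  hKc : IsCompact K
  hK0 : 0 ∈ interior K
  hKsm : ∃ g : Euc n → ℝ, ContDiff ℝ (⊤ : ℕ∞) g ∧ K = {x | g x ≤ 0} ∧
    ∀ x ∈ frontier K, fderiv ℝ g x ≠ 0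
  hKR₀ : K ⊆ ball 0 R₀
  hfsm : ContDiffOn ℝ (⊤ : ℕ∞) (fun p : Euc n × ℝ => f p.1 p.2) ((interior K)ᶜ ×ˢ univ)
  hfpos : ∀ x ∈ (interior K)ᶜ, ∀ z : ℝ, 0 < f x z
  hfz : ∀ x ∈ (interior K)ᶜ, Monotone (f x)
  hfdec : ∃ C : ℝ, ∀ x ∈ (interior K)ᶜ, ∀ z : ℝ, f x z * ‖x‖ ^ (n + 1) ≤ C
  hfder : ∃ C : ℝ, ∀ p ∈ (interior K)ᶜ ×ˢ (univ : Set ℝ),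
    ‖fderivWithin ℝ (fun q : Euc n × ℝ => f q.1 q.2) ((interior K)ᶜ ×ˢ univ) p‖ +
      ‖iteratedFDerivWithin ℝ 2 (fun q : Euc n × ℝ => f q.1 q.2) ((interior K)ᶜ ×ˢ univ) p‖
        ≤ C * f p.1 p.2
  hulsm : ContDiffOn ℝ (⊤ : ℕ∞) ul (interior K)ᶜ
  hulconv : ∀ x ∈ Kᶜ, (Hess ul x).PosDef
  hulsub : ∀ x ∈ Kᶜ, f x (ul x) ≤ gaussK ul x
  hulbc : ∀ x ∈ frontier K, ul x = u₀ x
  hulcone : ∃ C : ℝ, ∀ x ∈ (interior K)ᶜ, |ul x - ‖x‖| ≤ C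
  huldec1 : ∃ C R₁ : ℝ, ∀ x : Euc n, R₁ ≤ ‖x‖ →
    ‖fderiv ℝ (fun y => ul y - ‖y‖) x‖ ≤ C / ‖x‖
  huldec2 : ∃ C R₁ : ℝ, ∀ x : Euc n, R₁ ≤ ‖x‖ →
    ‖iteratedFDeriv ℝ 2 (fun y => ul y - ‖y‖) x‖ + ‖iteratedFDeriv ℝ 3 ul x‖ ≤ C / ‖x‖ ^ 2

/-- The domain `B_R ∖ int K` of the compact Dirichlet problem. -/
def solDom {n : ℕ} (S : ExtSetting n) (R : ℝ) : Set (Euc n) :=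
  closedBall 0 R \ interior S.K

/-- `u` is a smooth strictly convex solution `u^R` of the compact Dirichlet problem
`K[u^R] = f(x,u^R)` in `B_R ∖ K`, `u^R = u̲` on `∂B_R ∪ ∂K`. -/
def IsSol {n : ℕ} (S : ExtSetting n) (R : ℝ) (u : Euc n → ℝ) : Prop :=
  ContDiffOn ℝ (⊤ : ℕ∞) u (solDom S R) ∧
  (∀ x ∈ ball 0 R \ S.K, (Hess u x).PosDef) ∧
  (∀ x ∈ ball 0 R \ S.K, gaussK u x = S.f x (u x)) ∧
  (∀ x ∈ sphere (0 : Euc n) R ∪ frontier S.K, u x = S.ul x)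

/-- The tangential operator `Tw = w_t − (x_t/R)·w_n` (with `n` the last index). -/
noncomputable def Tlin {n : ℕ} (Ω : Set (Euc n)) (R : ℝ) (t last : Fin n) (w : Euc n → ℝ)
    (x : Euc n) : ℝ :=
  pdW Ω w x t - x t / R * pdW Ω w x last

/-- The linearized operator `Lw = u^{ij} w_{ij} − (n+2)/(1+|Du|²) uⁱ w_i`. -/
noncomputable def Llin {n : ℕ} (Ω : Set (Euc n)) (u w : Euc n → ℝ) (x : Euc n) : ℝ :=
  (∑ i, ∑ j, (HessW Ω u x)⁻¹ i j * HessW Ω w x i j) -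
    ((n : ℝ) + 2) / (1 + ∑ i, pdW Ω u x i ^ 2) * ∑ i, pdW Ω u x i * pdW Ω w x i

namespace Matrix

variable {m : Type*} [Fintype m] [DecidableEq m]

theorem PosSemidef.one_le_det_one_add {P : Matrix m m ℝ} (hP : P.PosSemidef) :
    1 ≤ (1 + P).det := by
  have hH : (1 + P).IsHermitian := Matrix.isHermitian_one.add hP.1
  rw [hH.det_eq_prod_eigenvalues]
  refine Finset.one_le_prod fun i _ => ?_
  have h1 := hH.eigenvalues_eq i
  have h2 := hP.dotProduct_mulVec_nonneg (hH.eigenvectorBasis i).ofLp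
  have h3 : star (hH.eigenvectorBasis i).ofLp ⬝ᵥ (hH.eigenvectorBasis i).ofLp = 1 := by
    have := hH.eigenvectorBasis.orthonormal.1 i
    have h4 := EuclideanSpace.real_norm_sq_eq (hH.eigenvectorBasis i)
    rw [this] at h4
    simp only [dotProduct, star_trivial]
    simp only [← sq]
    linarith
  rw [add_mulVec, one_mulVec, dotProduct_add, h3] at h1
  simp only [RCLike.re_to_real, RCLike.ofReal_real_eq_id, id] at h1 ⊢
  linarith

open scoped MatrixOrder Matrix.Norms.L2Operator in
theorem PosDef.det_le_det_add {A B : Matrix m m ℝ} (hA : A.PosDef) (hB : B.PosSemidef) :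
    A.det ≤ (A + B).det := by
  obtain ⟨y, hy, rfl⟩ := CStarAlgebra.isStrictlyPositive_iff_eq_star_mul_self.mp
    hA.isStrictlyPositive
  have hyd : IsUnit y.det := (isUnit_iff_isUnit_det y).1 hy
  have h1 : (y⁻¹ᴴ * B * y⁻¹).PosSemidef := hB.conjTranspose_mul_mul_same y⁻¹
  have h2 : star y * y + B = yᴴ * (1 + y⁻¹ᴴ * B * y⁻¹) * y := by
    have h3 : yᴴ * y⁻¹ᴴ = 1 := by
      rw [← conjTranspose_mul, nonsing_inv_mul _ hyd, conjTranspose_one]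
    have h4 : yᴴ * (y⁻¹ᴴ * B * y⁻¹) * y = (yᴴ * y⁻¹ᴴ) * B * (y⁻¹ * y) := by
      simp only [Matrix.mul_assoc]
    rw [mul_add, add_mul, h4, h3, nonsing_inv_mul _ hyd, mul_one, one_mul, mul_one,
      star_eq_conjTranspose]
  have h5 := h1.one_le_det_one_add
  rw [h2, det_mul, det_mul, star_eq_conjTranspose, det_mul, det_conjTranspose, star_trivial]
  nlinarith [mul_self_nonneg y.det]

theorem det_add_single_diag (A : Matrix m m ℝ) (k : m) (c : ℝ) :
    (A + single k k c).det = A.det + c * A.adjugate k k := by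
  have h : A + single k k c = A.updateRow k (A k + c • Pi.single k 1) := by
    ext i j
    by_cases hi : i = k
    · subst hi
      by_cases hj : i = j
      · subst hj; simp
      · have : j ≠ i := fun h => hj h.symm
        simp [hj, this]
    · simp [hi, Ne.symm hi]
  rw [h, det_updateRow_add, det_updateRow_smul, updateRow_eq_self, adjugate_apply]

theorem PosDef.inv_le_inv_apply {A : Matrix m m ℝ} (hA : A.PosDef) (k : m) :
    (A k k)⁻¹ ≤ A⁻¹ k k := by
  have hu : IsUnit A.det := (isUnit_iff_isUnit_det A).1 hA.isUnit
  have hpos : 0 < A k k := hA.diag_pos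
  set s := (A k k)⁻¹
  have h1 := hA.posSemidef.dotProduct_mulVec_nonneg (A⁻¹ *ᵥ Pi.single k 1 - s • Pi.single k 1)
  have h2 : A *ᵥ (A⁻¹ *ᵥ Pi.single k 1 - s • Pi.single k 1)
      = Pi.single k 1 - s • A *ᵥ Pi.single k 1 := by
    rw [mulVec_sub, mulVec_mulVec, mul_nonsing_inv _ hu, one_mulVec, mulVec_smul]
  have h3 : A⁻¹ *ᵥ Pi.single k 1 ⬝ᵥ A *ᵥ Pi.single k 1 = 1 := by
    have : A⁻¹ *ᵥ Pi.single k 1 ⬝ᵥ A *ᵥ Pi.single k 1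
        = (A *ᵥ Pi.single k 1) ⬝ᵥ A⁻¹ *ᵥ Pi.single k (1 : ℝ) := dotProduct_comm _ _
    rw [this, dotProduct_mulVec, vecMul_mulVec, ← conjTranspose_eq_transpose_of_trivial,
      hA.1.eq, mul_nonsing_inv _ hu]
    simp
  rw [h2, star_trivial, sub_dotProduct, dotProduct_sub, dotProduct_sub, smul_dotProduct,
    smul_dotProduct, dotProduct_smul, dotProduct_smul, h3] at h1
  simp at h1
  have h4 : s * A k k = 1 := inv_mul_cancel₀ hpos.ne'
  rw [h4] at h1
  linarith

theorem PosDef.le_det_add_single {A : Matrix m m ℝ} (hA : A.PosDef) (k : m) {c : ℝ}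
    (hc : 0 ≤ c) : A.det * (1 + c / A k k) ≤ (A + single k k c).det := by
  have h1 := hA.inv_le_inv_apply k
  have hd := hA.det_pos
  rw [det_add_single_diag]
  rw [inv_def, smul_apply, smul_eq_mul, Ring.inverse_eq_inv'] at h1
  have h2 : A.det * (A k k)⁻¹ ≤ A.adjugate k k := by
    have := mul_le_mul_of_nonneg_left h1 hd.le
    rwa [← mul_assoc, mul_inv_cancel₀ hd.ne', one_mul] at this
  rw [div_eq_mul_inv]
  nlinarith

theorem PosSemidef.abs_apply_le_trace {A : Matrix m m ℝ} (hA : A.PosSemidef) (i j : m) :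
    |A i j| ≤ A.trace := by
  have hs : A j i = A i j := by simpa using hA.1.apply i j
  have hd : ∀ k, A k k ≤ A.trace := fun k =>
    Finset.single_le_sum (f := fun k => A k k) (fun l _ => hA.diag_nonneg) (Finset.mem_univ k)
  have h1 := hA.dotProduct_mulVec_nonneg (Pi.single i 1 + Pi.single j 1)
  have h2 := hA.dotProduct_mulVec_nonneg (Pi.single i 1 - Pi.single j 1)
  simp [mulVec_add, add_dotProduct, mulVec_sub, sub_dotProduct] at h1 h2
  rw [abs_le]
  constructor <;> linarith [hd i, hd j]

theorem hasFDerivAt_det {E : Type*} [NormedAddCommGroup E] [NormedSpace ℝ E]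
    {H : E → Matrix m m ℝ} {H' : m → m → E →L[ℝ] ℝ} {x : E}
    (h : ∀ i j, HasFDerivAt (fun y => H y i j) (H' i j) x) :
    HasFDerivAt (fun y => (H y).det) (∑ i, ∑ j, (H x).adjugate j i • H' i j) x := by
  let f : ContinuousMultilinearMap ℝ (fun _ : m => m → ℝ) ℝ :=
    { toMultilinearMap := (detRowAlternating (n := m) (R := ℝ)).toMultilinearMap
      cont := by
        change Continuous fun M : Matrix m m ℝ => M.det
        exact continuous_id.matrix_det }
  have h1 : ∀ i, HasFDerivAt (fun y => H y i) (ContinuousLinearMap.pi (H' i)) x := fun i =>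
    hasFDerivAt_pi.2 (h i)
  have h2 := HasFDerivAt.multilinear_comp f h1
  refine h2.congr_fderiv ?_
  ext v
  simp only [_root_.sum_apply, ContinuousLinearMap.comp_apply,
    _root_.smul_apply, smul_eq_mul]
  refine Finset.sum_congr rfl fun i _ => ?_
  have h3 : (f.toContinuousLinearMap (fun j => H x j) i) ((ContinuousLinearMap.pi (H' i)) v)
      = ((H x).updateRow i (fun j => H' i j v)).det := rfl
  rw [h3, ← cramer_transpose_apply, cramer_eq_adjugate_mulVec, ← adjugate_transpose]
  simp [mulVec, dotProduct]

end Matrix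

section

open scoped ContDiff

variable {n : ℕ}

/-- The `i`-th partial derivative. -/
def partialDeriv (i : Fin n) (w : Euc n → ℝ) (x : Euc n) : ℝ :=
  fderiv ℝ w x (EuclideanSpace.single i 1)

theorem ContDiffAt.partialDeriv {w : Euc n → ℝ} {x : Euc n} (hw : ContDiffAt ℝ ∞ w x) (i : Fin n) :
    ContDiffAt ℝ ∞ (partialDeriv i w) x :=
  (hw.fderiv_right (m := ∞) (by simp)).clm_apply contDiffAt_const

theorem ContDiffAt.differentiableAt_fderiv {w : Euc n → ℝ} {x : Euc n}
    (hw : ContDiffAt ℝ ∞ w x) : DifferentiableAt ℝ (fderiv ℝ w) x :=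
  (hw.fderiv_right (m := ∞) (by simp)).differentiableAt (by simp)

theorem partialDeriv_partialDeriv {w : Euc n → ℝ} {x : Euc n} (hw : ContDiffAt ℝ ∞ w x) (i j : Fin n) :
    partialDeriv i (partialDeriv j w) x =
      fderiv ℝ (fderiv ℝ w) x (EuclideanSpace.single i 1) (EuclideanSpace.single j 1) := by
  unfold partialDeriv
  rw [fderiv_clm_apply hw.differentiableAt_fderiv (differentiableAt_const _)]
  simp

theorem Hess_apply {w : Euc n → ℝ} {x : Euc n} (hw : ContDiffAt ℝ ∞ w x) (i j : Fin n) :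
    Hess w x i j = partialDeriv i (partialDeriv j w) x := by
  rw [partialDeriv_partialDeriv hw, Hess, iteratedFDeriv_two_apply]
  simp

theorem partialDeriv_comm {w : Euc n → ℝ} {x : Euc n} (hw : ContDiffAt ℝ ∞ w x) (i j : Fin n) :
    partialDeriv i (partialDeriv j w) x = partialDeriv j (partialDeriv i w) x := by
  rw [partialDeriv_partialDeriv hw, partialDeriv_partialDeriv hw]
  exact (hw.isSymmSndFDerivAt (by simpa using WithTop.coe_le_coe.2 (le_top : (2 : ℕ∞) ≤ ⊤))) _ _

theorem Filter.EventuallyEq.partialDeriv {w v : Euc n → ℝ} {x : Euc n} (h : w =ᶠ[𝓝 x] v)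
    (i : Fin n) : partialDeriv i w =ᶠ[𝓝 x] partialDeriv i v := by
  filter_upwards [h.fderiv (𝕜 := ℝ)] with y hy
  simp only [_root_.partialDeriv, hy]

theorem EuclideanSpace.sum_smul_single (v : Euc n) :
    ∑ i, v i • EuclideanSpace.single i (1 : ℝ) = v := by
  simpa using (EuclideanSpace.basisFun (Fin n) ℝ).sum_repr v

theorem fderiv_fderiv_apply_eq_dotProduct {w : Euc n → ℝ} {x : Euc n}
    (hw : ContDiffAt ℝ ∞ w x) (v : Euc n) :
    fderiv ℝ (fderiv ℝ w) x v v = (v : Fin n → ℝ) ⬝ᵥ (Hess w x).mulVec v := by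
  conv_lhs => rw [← EuclideanSpace.sum_smul_single v]
  simp only [map_sum, map_smul, _root_.sum_apply, _root_.smul_apply, smul_eq_mul, dotProduct,
    Matrix.mulVec, Hess_apply hw, partialDeriv_partialDeriv hw, Finset.mul_sum]
  rw [Finset.sum_comm]
  refine Finset.sum_congr rfl fun i _ => Finset.sum_congr rfl fun j _ => ?_
  ring

theorem norm_clm_sq_eq_sum (ℓ : Euc n →L[ℝ] ℝ) :
    ‖ℓ‖ ^ 2 = ∑ i, ℓ (EuclideanSpace.single i 1) ^ 2 := by
  rw [← (InnerProductSpace.toDual ℝ (Euc n)).symm.norm_map, EuclideanSpace.real_norm_sq_eq]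
  refine Finset.sum_congr rfl fun i _ => ?_
  rw [← InnerProductSpace.toDual_symm_apply (y := ℓ), EuclideanSpace.inner_single_right]
  simp

theorem norm_fderiv_sq_eq_sum (w : Euc n → ℝ) (x : Euc n) :
    ‖fderiv ℝ w x‖ ^ 2 = ∑ i, partialDeriv i w x ^ 2 :=
  norm_clm_sq_eq_sum _

theorem abs_partialDeriv_le (w : Euc n → ℝ) (x : Euc n) (i : Fin n) :
    |partialDeriv i w x| ≤ ‖fderiv ℝ w x‖ := by
  simpa [partialDeriv] using (fderiv ℝ w x).le_opNorm (EuclideanSpace.single i 1)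

theorem hasDerivAt_line (a v : Euc n) (s : ℝ) : HasDerivAt (fun s : ℝ => a + s • v) v s := by
  simpa using ((hasDerivAt_id s).smul_const v).const_add a

theorem hasDerivAt_comp_line {w : Euc n → ℝ} {a v : Euc n} {s : ℝ}
    (hw : DifferentiableAt ℝ w (a + s • v)) :
    HasDerivAt (fun s => w (a + s • v)) (fderiv ℝ w (a + s • v) v) s :=
  hw.hasFDerivAt.comp_hasDerivAt s (hasDerivAt_line a v s)

theorem hasDerivAt_fderiv_line {w : Euc n → ℝ} {a v : Euc n} {s : ℝ}
    (hw : ContDiffAt ℝ ∞ w (a + s • v)) :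
    HasDerivAt (fun s => fderiv ℝ w (a + s • v) v)
      (fderiv ℝ (fderiv ℝ w) (a + s • v) v v) s := by
  have h := hw.differentiableAt_fderiv.hasFDerivAt.comp_hasDerivAt s (hasDerivAt_line a v s)
  simpa using h.clm_apply (hasDerivAt_const s v)

theorem convexOn_comp_line {U D : Set (Euc n)}
    {w : Euc n → ℝ} (hD : ContinuousOn w D) (hw : ∀ x ∈ U, ContDiffAt ℝ ∞ w x)
    (hH : ∀ x ∈ U, (Hess w x).PosDef) {a v : Euc n} {l r : ℝ}
    (hI : ∀ s ∈ Icc l r, a + s • v ∈ D) (hIo : ∀ s ∈ Ioo l r, a + s • v ∈ U) :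
    ConvexOn ℝ (Icc l r) fun s => w (a + s • v) := by
  have hcl : Continuous fun s : ℝ => a + s • v := by fun_prop
  have hd : ∀ s ∈ Ioo l r, deriv (fun s => w (a + s • v)) s = fderiv ℝ w (a + s • v) v :=
    fun s hs => (hasDerivAt_comp_line ((hw _ (hIo s hs)).differentiableAt (by simp))).deriv
  have hd2 : ∀ s ∈ Ioo l r, HasDerivAt (deriv fun s => w (a + s • v))
      (fderiv ℝ (fderiv ℝ w) (a + s • v) v v) s := fun s hs =>
    (hasDerivAt_fderiv_line (hw _ (hIo s hs))).congr_of_eventuallyEq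
      (by filter_upwards [isOpen_Ioo.mem_nhds hs] with y hy using hd y hy)
  refine convexOn_of_deriv2_nonneg (convex_Icc l r) (hD.comp hcl.continuousOn hI) ?_ ?_ ?_
  · rw [interior_Icc]
    exact fun s hs => (hasDerivAt_comp_line ((hw _ (hIo s hs)).differentiableAt
      (by simp))).differentiableAt.differentiableWithinAt
  · rw [interior_Icc]
    exact fun s hs => (hd2 s hs).differentiableAt.differentiableWithinAt
  · rw [interior_Icc]
    intro s hs
    rw [Function.iterate_succ, Function.iterate_one, Function.comp, (hd2 s hs).deriv,
      fderiv_fderiv_apply_eq_dotProduct (hw _ (hIo s hs))]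
    simpa using (hH _ (hIo s hs)).posSemidef.dotProduct_mulVec_nonneg (v : Fin n → ℝ)

theorem IsLocalMin.deriv_deriv_nonneg {g : ℝ → ℝ} {s : ℝ} (h : IsLocalMin g s)
    (hc : ContinuousAt g s) : 0 ≤ deriv (deriv g) s := by
  by_contra! hneg
  have hmax := isLocalMax_of_deriv_deriv_neg hneg h.deriv_eq_zero hc
  have heq : g =ᶠ[𝓝 s] fun _ => g s := by
    filter_upwards [h, hmax] with y h1 h2 using le_antisymm h2 h1
  have h2 : deriv (deriv g) s = 0 := by
    rw [heq.deriv.deriv_eq]; simp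
  linarith

theorem IsLocalMin.posSemidef_Hess {w : Euc n → ℝ} {x : Euc n} (h : IsLocalMin w x)
    (hw : ContDiffAt ℝ ∞ w x) (hev : ∀ᶠ y in 𝓝 x, ContDiffAt ℝ ∞ w y) :
    (Hess w x).PosSemidef := by
  refine Matrix.PosSemidef.of_dotProduct_mulVec_nonneg ?_ fun v => ?_
  · ext i j
    simp [Hess_apply hw, partialDeriv_comm hw i j]
  · have hcl : Continuous fun s : ℝ => x + s • (WithLp.toLp 2 v : Euc n) := by fun_prop
    have h0 : x + (0 : ℝ) • (WithLp.toLp 2 v : Euc n) = x := by simp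
    have ht : Tendsto (fun s : ℝ => x + s • (WithLp.toLp 2 v : Euc n)) (𝓝 0) (𝓝 x) := by
      simpa using hcl.tendsto 0
    have hmin : IsLocalMin (fun s : ℝ => w (x + s • (WithLp.toLp 2 v : Euc n))) 0 := by
      have := ht.eventually h
      simpa [IsLocalMin, IsMinFilter] using this
    have hca : ContinuousAt (fun s : ℝ => w (x + s • (WithLp.toLp 2 v : Euc n))) 0 :=
      ContinuousAt.comp (by simpa using hw.continuousAt) hcl.continuousAt
    have hd : deriv (fun s : ℝ => w (x + s • (WithLp.toLp 2 v : Euc n))) =ᶠ[𝓝 0]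
        fun s => fderiv ℝ w (x + s • (WithLp.toLp 2 v : Euc n)) (WithLp.toLp 2 v) := by
      filter_upwards [ht.eventually hev] with s hs
      exact (hasDerivAt_comp_line (hs.differentiableAt (by simp))).deriv
    have h2 := hmin.deriv_deriv_nonneg hca
    rw [hd.deriv_eq, (hasDerivAt_fderiv_line (by simpa using hw)).deriv, h0,
      fderiv_fderiv_apply_eq_dotProduct hw] at h2
    simpa using h2

theorem Matrix.PosDef.le_det_of_posSemidef_sub {m : Type*} [Fintype m] [DecidableEq m]
    {A B : Matrix m m ℝ} (hA : A.PosDef) (k : m) {c : ℝ} (hc : 0 ≤ c)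
    (hB : (B - A - Matrix.single k k c).PosSemidef) : A.det * (1 + c / A k k) ≤ B.det := by
  have h1 : (Matrix.single k k c).PosSemidef := by
    rw [← Matrix.diagonal_single]
    exact Matrix.PosSemidef.diagonal (by simpa using hc)
  have h2 := (hA.add_posSemidef h1).det_le_det_add hB
  have h3 : A + Matrix.single k k c + (B - A - Matrix.single k k c) = B := by abel
  rw [h3] at h2
  exact (hA.le_det_add_single k hc).trans h2

theorem isOpen_ball_diff (S : ExtSetting n) (R : ℝ) : IsOpen (ball 0 R \ S.K) :=
  isOpen_ball.sdiff S.hKc.isClosed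

theorem ball_diff_subset_solDom (S : ExtSetting n) (R : ℝ) : ball 0 R \ S.K ⊆ solDom S R :=
  fun _ hx => ⟨ball_subset_closedBall hx.1, fun h => hx.2 (interior_subset h)⟩

theorem solDom_mem_nhds (S : ExtSetting n) {R : ℝ} {x : Euc n} (hx : x ∈ ball 0 R \ S.K) :
    solDom S R ∈ 𝓝 x :=
  mem_of_superset ((isOpen_ball_diff S R).mem_nhds hx) (ball_diff_subset_solDom S R)

theorem isCompact_solDom (S : ExtSetting n) (R : ℝ) : IsCompact (solDom S R) :=
  (isCompact_closedBall 0 R).diff isOpen_interior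

theorem IsSol.contDiffAt {S : ExtSetting n} {R : ℝ} {u : Euc n → ℝ} (hu : IsSol S R u)
    {x : Euc n} (hx : x ∈ ball 0 R \ S.K) : ContDiffAt ℝ ∞ u x :=
  hu.1.contDiffAt (solDom_mem_nhds S hx)

theorem ExtSetting.contDiffAt_ul (S : ExtSetting n) {x : Euc n} (hx : x ∉ S.K) :
    ContDiffAt ℝ ∞ S.ul x :=
  S.hulsm.contDiffAt (mem_of_superset (S.hKc.isClosed.isOpen_compl.mem_nhds hx)
    (compl_subset_compl.2 interior_subset))

theorem ExtSetting.solDom_subset (S : ExtSetting n) (R : ℝ) : solDom S R ⊆ (interior S.K)ᶜ :=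
  fun _ hx => hx.2

theorem IsSol.eq_ul {S : ExtSetting n} {R : ℝ} {u : Euc n → ℝ} (hu : IsSol S R u)
    {x : Euc n} (hx : x ∈ solDom S R) (hx' : x ∉ ball 0 R \ S.K) : u x = S.ul x := by
  refine hu.2.2.2 x ?_
  by_cases hK : x ∈ S.K
  · exact Or.inr ⟨subset_closure hK, hx.2⟩
  · left
    have h1 : x ∉ ball 0 R := fun h => hx' ⟨h, hK⟩
    have h2 := hx.1
    simp only [mem_ball, mem_closedBall, mem_sphere, not_lt] at *
    exact le_antisymm h2 h1

theorem hasFDerivAt_exp_coord (γ : ℝ) (k : Fin n) (x : Euc n) :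
    HasFDerivAt (fun y : Euc n => Real.exp (γ * y k))
      ((γ * Real.exp (γ * x k)) • (EuclideanSpace.proj k : Euc n →L[ℝ] ℝ)) x := by
  have h := (((EuclideanSpace.proj k : Euc n →L[ℝ] ℝ).hasFDerivAt (x := x)).const_mul γ).exp
  refine h.congr_fderiv ?_
  ext v
  simp
  ring

theorem contDiff_exp_coord (γ : ℝ) (k : Fin n) :
    ContDiff ℝ ∞ (fun y : Euc n => Real.exp (γ * y k)) :=
  (contDiff_const.mul (EuclideanSpace.proj k : Euc n →L[ℝ] ℝ).contDiff).exp

theorem Hess_exp_coord (γ : ℝ) (k : Fin n) (x : Euc n) :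
    Hess (fun y : Euc n => Real.exp (γ * y k)) x =
      Matrix.single k k (γ ^ 2 * Real.exp (γ * x k)) := by
  have h1 : ∀ j, partialDeriv j (fun y : Euc n => Real.exp (γ * y k)) =
      fun x => (γ * (if k = j then 1 else 0)) * Real.exp (γ * x k) := by
    intro j
    ext y
    simp only [partialDeriv, (hasFDerivAt_exp_coord γ k y).fderiv]
    simp
  ext i j
  rw [Hess_apply (contDiff_exp_coord γ k).contDiffAt, h1, partialDeriv,
    ((hasFDerivAt_exp_coord γ k x).const_mul _).fderiv]
  rcases eq_or_ne k i with rfl | hi <;> rcases eq_or_ne k j with rfl | hj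
  · simp; ring
  · simp [hj]
  · simp [hi]
  · simp [hi, hj]

theorem partialDeriv_sub {w v : Euc n → ℝ} {x : Euc n} (hw : DifferentiableAt ℝ w x)
    (hv : DifferentiableAt ℝ v x) (i : Fin n) :
    partialDeriv i (fun y => w y - v y) x = partialDeriv i w x - partialDeriv i v x := by
  simp [partialDeriv, fderiv_fun_sub hw hv]

theorem Hess_sub {w v : Euc n → ℝ} {x : Euc n} (hw : ContDiffAt ℝ ∞ w x)
    (hv : ContDiffAt ℝ ∞ v x) (hw' : ∀ᶠ y in 𝓝 x, ContDiffAt ℝ ∞ w y)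
    (hv' : ∀ᶠ y in 𝓝 x, ContDiffAt ℝ ∞ v y) :
    Hess (fun y => w y - v y) x = Hess w x - Hess v x := by
  ext i j
  have h : partialDeriv j (fun y => w y - v y) =ᶠ[𝓝 x]
      fun y => partialDeriv j w y - partialDeriv j v y := by
    filter_upwards [hw', hv'] with y h1 h2
    exact partialDeriv_sub (h1.differentiableAt (by simp)) (h2.differentiableAt (by simp)) j
  rw [Matrix.sub_apply, Hess_apply (hw.sub hv), Hess_apply hw, Hess_apply hv]
  rw [(h.partialDeriv i).eq_of_nhds]
  exact partialDeriv_sub ((hw.partialDeriv j).differentiableAt (by simp))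
    ((hv.partialDeriv j).differentiableAt (by simp)) i

theorem Hess_const_mul {w : Euc n → ℝ} {x : Euc n} (hw : ContDiffAt ℝ ∞ w x) (c : ℝ) :
    Hess (fun y => c * w y) x = c • Hess w x := by
  ext i j
  have h : ∀ (v : Euc n → ℝ) (j : Fin n),
      partialDeriv j (fun y => c * v y) = fun y => c * partialDeriv j v y := by
    intro v j; ext y
    have : fderiv ℝ (fun y => c * v y) y = c • fderiv ℝ v y :=
      congrFun (fderiv_const_smul_field (f := v) c) y
    simp [partialDeriv, this]
  rw [Hess_apply (contDiffAt_const.mul hw), h, h, Matrix.smul_apply, Hess_apply hw, smul_eq_mul]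

theorem one_add_mul_lt_of_le_exp {q m P g : ℝ} (hq : 0 < q) (hm : 0 ≤ m) (hP : 0 ≤ P)
    (hq1 : q ≤ 1) (hz : q * (m * (2 * P + 1)) ≤ 1)
    (h : 1 + q * g ≤ Real.exp ((2 * P * q + q ^ 2) * m)) : g ≤ 2 * (m * (2 * P + 1)) := by
  set z := (2 * P * q + q ^ 2) * m
  have hmP : 0 ≤ m * P := mul_nonneg hm hP
  have hz0 : 0 ≤ z := by simp only [z]; positivity
  have hzq : z ≤ q * (m * (2 * P + 1)) := by
    have : q ^ 2 * m ≤ q * m := mul_le_mul_of_nonneg_right (by nlinarith) hm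
    simp only [z]; nlinarith
  have h1 := Real.abs_exp_sub_one_sub_id_le (x := z) (by rw [abs_of_nonneg hz0]; linarith)
  have h2 := (abs_le.1 h1).2
  have h3 : q * g ≤ q * (2 * (m * (2 * P + 1))) := by nlinarith
  exact le_of_mul_le_mul_left h3 hq

theorem curvature_ratio_le {a b P q m : ℝ} (ha : 0 ≤ a) (haP : a ≤ P) (hb : 0 ≤ b)
    (hba : b ≤ a + q) (hq : 0 ≤ q) (hm : 0 ≤ m) :
    (1 + b ^ 2) ^ m ≤ (1 + a ^ 2) ^ m * Real.exp ((2 * P * q + q ^ 2) * m) := by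
  have h1 : 1 + b ^ 2 ≤ (1 + a ^ 2) * Real.exp (2 * P * q + q ^ 2) := by
    have h2 := Real.add_one_le_exp (2 * P * q + q ^ 2)
    have h3 : b ^ 2 ≤ (a + q) ^ 2 := by gcongr
    have h4 : a * q ≤ P * q := by gcongr
    have h5 : 0 ≤ P * q := mul_nonneg (ha.trans haP) hq
    nlinarith [mul_nonneg (sq_nonneg a) h5, sq_nonneg (a * q),
      mul_le_mul_of_nonneg_left h2 (by positivity : 0 ≤ 1 + a ^ 2)]
  rw [Real.exp_mul, ← Real.mul_rpow (by positivity) (Real.exp_pos _).le]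
  exact Real.rpow_le_rpow (by positivity) h1 hm

theorem ContinuousOn.fderiv_of_contDiffAt {w : Euc n → ℝ} {N : Set (Euc n)}
    (h : ∀ x ∈ N, ContDiffAt ℝ ∞ w x) : ContinuousOn (fderiv ℝ w) N := fun x hx =>
  ((h x hx).fderiv_right (m := ∞) (by simp)).continuousAt.continuousWithinAt

theorem IsCompact.exists_bound_pos {N : Set (Euc n)} (hN : IsCompact N) {F : Type*}
    [SeminormedAddCommGroup F] {g : Euc n → F} (hg : ContinuousOn g N) :
    ∃ C : ℝ, 0 < C ∧ ∀ x ∈ N, ‖g x‖ ≤ C := by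
  obtain ⟨C, hC⟩ := hN.exists_bound_of_continuousOn hg
  exact ⟨max C 1, by positivity, fun x hx => (hC x hx).trans (le_max_left _ _)⟩

/-- At an interior minimum of `u - u̲ - ε e^{γ x_k}` where `u ≤ u̲`, the equation for `u` and the
inequality for `u̲` bound the gain in the determinant by the gain in the gradient factor. -/
theorem IsSol.one_add_le_exp_of_isLocalMin {S : ExtSetting n} {R : ℝ} {u : Euc n → ℝ}
    (hu : IsSol S R u) {x : Euc n} (hx : x ∈ ball 0 R \ S.K) (hle : u x ≤ S.ul x) (k : Fin n)
    {ε γ P Λ : ℝ} (hε : 0 < ε) (hγ : 0 < γ)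
    (hmin : IsLocalMin (fun y => u y - (S.ul y + ε * Real.exp (γ * y k))) x)
    (hP : ‖fderiv ℝ S.ul x‖ ≤ P) (hΛ : Hess S.ul x k k ≤ Λ) :
    1 + ε * (γ * Real.exp (γ * x k)) * (γ / Λ) ≤
      Real.exp ((2 * P * (ε * (γ * Real.exp (γ * x k))) +
        (ε * (γ * Real.exp (γ * x k))) ^ 2) * (((n : ℝ) + 2) / 2)) := by
  set E := Real.exp (γ * x k)
  have hE : 0 < E := Real.exp_pos _
  have hKx : x ∈ (interior S.K)ᶜ := fun h => hx.2 (interior_subset h)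
  have hU := (isOpen_ball_diff S R).mem_nhds hx
  have hue : ∀ᶠ y in 𝓝 x, ContDiffAt ℝ ∞ u y := by
    filter_upwards [hU] with y hy using hu.contDiffAt hy
  have hle' : ∀ᶠ y in 𝓝 x, ContDiffAt ℝ ∞ S.ul y := by
    filter_upwards [hU] with y hy using S.contDiffAt_ul hy.2
  have hux := hue.self_of_nhds
  have hlx := hle'.self_of_nhds
  have hφ : ∀ y, ContDiffAt ℝ ∞ (fun y : Euc n => ε * Real.exp (γ * y k)) y := fun y =>
    contDiffAt_const.mul (contDiff_exp_coord γ k).contDiffAt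
  have hue1 : ∀ᶠ y in 𝓝 x, ContDiffAt ℝ ∞ (fun y => u y - S.ul y) y := by
    filter_upwards [hue, hle'] with y h1 h2 using h1.sub h2
  have hEq : (fun y => u y - (S.ul y + ε * Real.exp (γ * y k))) =
      fun y => (u y - S.ul y) - ε * Real.exp (γ * y k) := by ext y; ring
  rw [hEq] at hmin
  have hHess := hmin.posSemidef_Hess (hue1.self_of_nhds.sub (hφ x))
    (by filter_upwards [hue1] with y h1 using h1.sub (hφ y))
  rw [Hess_sub hue1.self_of_nhds (hφ x) hue1 (Eventually.of_forall hφ),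
    Hess_sub hux hlx hue hle', Hess_const_mul (contDiff_exp_coord γ k).contDiffAt,
    Hess_exp_coord, Matrix.smul_single] at hHess
  have hA := S.hulconv x hx.2
  have hdet := hA.le_det_of_posSemidef_sub k (by positivity) hHess
  have hAk : 0 < Hess S.ul x k k := hA.diag_pos
  have hgrad : fderiv ℝ u x = fderiv ℝ S.ul x +
      (ε * (γ * E)) • (EuclideanSpace.proj k : Euc n →L[ℝ] ℝ) := by
    have h0 := hmin.fderiv_eq_zero
    have hd : HasFDerivAt (fun y => (u y - S.ul y) - ε * Real.exp (γ * y k)) _ x :=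
      (((hux.differentiableAt (by simp)).hasFDerivAt.sub
        (hlx.differentiableAt (by simp)).hasFDerivAt).sub
        ((hasFDerivAt_exp_coord γ k x).const_mul ε))
    rw [hd.fderiv, sub_eq_zero, sub_eq_iff_eq_add', smul_smul] at h0
    exact h0
  set q := ε * (γ * E) with hq
  have hqpos : 0 < q := by positivity
  have hnorm : ‖fderiv ℝ u x‖ ≤ ‖fderiv ℝ S.ul x‖ + q := by
    rw [hgrad]
    refine (norm_add_le _ _).trans ?_
    gcongr
    rw [norm_smul, Real.norm_of_nonneg hqpos.le]
    have : ‖(EuclideanSpace.proj k : Euc n →L[ℝ] ℝ)‖ ≤ 1 :=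
      ContinuousLinearMap.opNorm_le_bound _ zero_le_one fun v => by
        simpa using PiLp.norm_apply_le v k
    nlinarith
  set m : ℝ := ((n : ℝ) + 2) / 2
  have hm : 0 ≤ m := by positivity
  have hcurv := curvature_ratio_le (norm_nonneg _) hP (norm_nonneg _) hnorm hqpos.le hm
  have heq := hu.2.2.1 x hx
  have hsub := S.hulsub x hx.2
  have hmono := S.hfz x hKx hle
  have hfp := S.hfpos x hKx (S.ul x)
  simp only [gaussK] at heq hsub
  have hw1 : 0 < (1 + ‖fderiv ℝ u x‖ ^ 2) ^ m := by positivity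
  have hw2 : 0 < (1 + ‖fderiv ℝ S.ul x‖ ^ 2) ^ m := by positivity
  rw [div_eq_iff hw1.ne'] at heq
  rw [le_div_iff₀ hw2] at hsub
  have hdp := hA.det_pos
  have hchain : (Hess u x).det ≤ (Hess S.ul x).det * Real.exp ((2 * P * q + q ^ 2) * m) := by
    calc (Hess u x).det = S.f x (u x) * (1 + ‖fderiv ℝ u x‖ ^ 2) ^ m := heq
      _ ≤ S.f x (S.ul x) * ((1 + ‖fderiv ℝ S.ul x‖ ^ 2) ^ m *
            Real.exp ((2 * P * q + q ^ 2) * m)) := by gcongr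
      _ = (S.f x (S.ul x) * (1 + ‖fderiv ℝ S.ul x‖ ^ 2) ^ m) *
            Real.exp ((2 * P * q + q ^ 2) * m) := by ring
      _ ≤ _ := by gcongr
  have h1 := le_of_mul_le_mul_left (hdet.trans hchain) hdp
  refine le_trans ?_ h1
  have h2 : q * (γ / Λ) = ε * (γ ^ 2 * E) / Λ := by rw [hq]; ring
  rw [h2, smul_eq_mul]
  gcongr

theorem IsSol.ul_le {S : ExtSetting n} {R : ℝ} {u : Euc n → ℝ} (hu : IsSol S R u)
    {x : Euc n} (hx : x ∈ solDom S R) : S.ul x ≤ u x := by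
  by_contra! hlt
  set η := S.ul x - u x with hη
  have hηpos : 0 < η := sub_pos.2 hlt
  have hcont : ContinuousOn (fun y => u y - S.ul y) (solDom S R) :=
    hu.1.continuousOn.sub (S.hulsm.continuousOn.mono (S.solDom_subset R))
  have hcpt := isCompact_solDom S R
  set N := {y ∈ solDom S R | u y - S.ul y ≤ -(η / 2)} with hN
  have hNc : IsCompact N := by
    have h1 : N = solDom S R ∩ (fun y => u y - S.ul y) ⁻¹' Iic (-(η / 2)) := rfl
    rw [h1]
    exact hcpt.of_isClosed_subset (hcont.preimage_isClosed_of_isClosed hcpt.isClosed isClosed_Iic)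
      inter_subset_left
  have hNU : N ⊆ ball 0 R \ S.K := by
    intro y hy
    by_contra hy'
    have := hu.eq_ul hy.1 hy'
    have h2 := hy.2
    linarith
  have hNsm : ∀ y ∈ N, ContDiffAt ℝ ∞ S.ul y := fun y hy => S.contDiffAt_ul (hNU hy).2
  let k : Fin n := ⟨0, by have := S.hn; omega⟩
  obtain ⟨P, hP0, hP⟩ := hNc.exists_bound_pos (ContinuousOn.fderiv_of_contDiffAt hNsm)
  have hHc : ContinuousOn (fun y => Hess S.ul y k k) N := by
    have h1 : ContinuousOn (partialDeriv k (partialDeriv k S.ul)) N := fun y hy =>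
      (((hNsm y hy).partialDeriv k).partialDeriv k).continuousAt.continuousWithinAt
    exact h1.congr fun y hy => Hess_apply (hNsm y hy) k k
  obtain ⟨Λ, hΛ0, hΛ⟩ := hNc.exists_bound_pos hHc
  set m : ℝ := ((n : ℝ) + 2) / 2
  have hm : 0 ≤ m := by positivity
  set γ := Λ * (2 * (m * (2 * P + 1)) + 1) with hγ
  have hγ0 : 0 < γ := by positivity
  set M := Real.exp (γ * R)
  have hM : 0 < M := Real.exp_pos _
  set D := γ * M + γ * M * (m * (2 * P + 1)) + 4 * M / η
  have hD : 0 < D := by positivity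
  set ε := D⁻¹
  have hε : 0 < ε := by positivity
  have hεD : ε * D = 1 := inv_mul_cancel₀ hD.ne'
  have hsplit : ε * (γ * M) + ε * (γ * M) * (m * (2 * P + 1)) + ε * (4 * M / η) = 1 := by
    refine Eq.trans ?_ hεD
    simp only [D]; ring
  have hp1 : 0 ≤ ε * (γ * M) := by positivity
  have hp2 : 0 ≤ ε * (γ * M) * (m * (2 * P + 1)) := by positivity
  have hp3 : 0 ≤ ε * (4 * M / η) := by positivity
  have hεM : ε * M ≤ η / 2 := by
    have h1 : ε * (4 * M / η) ≤ 1 := by linarith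
    have h2 : ε * (4 * M / η) = 4 * (ε * M) / η := by ring
    rw [h2, div_le_one hηpos] at h1
    linarith
  have hexp : ∀ y ∈ solDom S R, Real.exp (γ * y k) ≤ M := fun y hy => by
    have h1 := PiLp.norm_apply_le y k
    have h2 : ‖y‖ ≤ R := by simpa using hy.1
    have h3 : y k ≤ R := (le_abs_self _).trans (h1.trans h2)
    exact Real.exp_le_exp.2 (by gcongr)
  have hvc : ContinuousOn (fun y => u y - (S.ul y + ε * Real.exp (γ * y k))) (solDom S R) := by
    have h1 : ContinuousOn (fun y : Euc n => ε * Real.exp (γ * y k)) (solDom S R) :=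
      (continuous_const.mul (contDiff_exp_coord γ k).continuous).continuousOn
    refine (hcont.sub h1).congr fun y _ => ?_
    simp only [Pi.sub_apply]; ring
  obtain ⟨z, hz, hzmin⟩ := hcpt.exists_isMinOn ⟨x, hx⟩ hvc
  have hzx : u z - (S.ul z + ε * Real.exp (γ * z k)) ≤ u x - (S.ul x + ε * Real.exp (γ * x k)) :=
    hzmin hx
  have hzN : z ∈ N := by
    refine ⟨hz, ?_⟩
    have h1 := mul_le_mul_of_nonneg_left (hexp z hz) hε.le
    have h2 : 0 ≤ ε * Real.exp (γ * x k) := by positivity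
    linarith
  have hzU := hNU hzN
  have hzlt : u z ≤ S.ul z := by have := hzN.2; linarith
  have hloc := hzmin.isLocalMin (solDom_mem_nhds S hzU)
  have hmain := hu.one_add_le_exp_of_isLocalMin hzU hzlt k hε hγ0 hloc (hP z hzN)
    ((le_abs_self _).trans (hΛ z hzN))
  set E := Real.exp (γ * z k)
  have hE : 0 < E := Real.exp_pos _
  have hqM : ε * (γ * E) ≤ ε * (γ * M) := by
    have := hexp z hz
    gcongr
  have hfin := one_add_mul_lt_of_le_exp (by positivity) hm hP0.le (by linarith)
    ((mul_le_mul_of_nonneg_right hqM (by positivity)).trans (by linarith)) hmain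
  rw [hγ, mul_div_cancel_left₀ _ hΛ0.ne'] at hfin
  linarith

theorem exists_decay_of_eventually {R₀ : ℝ} (hR₀ : 0 < R₀) (g : Euc n → ℝ) (p : ℕ)
    (hg : ContinuousOn g {x | R₀ ≤ ‖x‖})
    (h : ∃ C R₁ : ℝ, ∀ x : Euc n, R₁ ≤ ‖x‖ → g x ≤ C / ‖x‖ ^ p) :
    ∃ C : ℝ, 0 < C ∧ ∀ x : Euc n, R₀ ≤ ‖x‖ → g x ≤ C / ‖x‖ ^ p := by
  obtain ⟨C, R₁, hC⟩ := h
  have hcpt : IsCompact (closedBall (0 : Euc n) R₁ ∩ {x | R₀ ≤ ‖x‖}) :=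
    (isCompact_closedBall 0 R₁).inter_right (isClosed_le continuous_const continuous_norm)
  obtain ⟨C', hC'0, hC'⟩ := hcpt.exists_bound_pos (g := fun x => g x * ‖x‖ ^ p)
    ((hg.mono inter_subset_right).mul (continuous_norm.pow p).continuousOn)
  refine ⟨max C C', lt_max_of_lt_right hC'0, fun x hx => ?_⟩
  have hx0 : 0 < ‖x‖ := hR₀.trans_le hx
  rcases le_total R₁ ‖x‖ with h1 | h1
  · refine (hC x h1).trans ?_
    gcongr
    exact le_max_left _ _
  · rw [le_div_iff₀ (by positivity)]
    exact (le_abs_self _).trans ((hC' x ⟨by simpa using h1, hx⟩).trans (le_max_right _ _))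

theorem hasFDerivAt_norm {x : Euc n} (hx : x ≠ 0) :
    HasFDerivAt (fun y : Euc n => ‖y‖) (‖x‖⁻¹ • innerSL ℝ x) x := by
  have h := (hasStrictFDerivAt_norm_sq x).hasFDerivAt.sqrt (by simpa using hx)
  have h1 : (fun y : Euc n => Real.sqrt (‖y‖ ^ 2)) = fun y => ‖y‖ := by
    ext y; exact Real.sqrt_sq (norm_nonneg y)
  rw [h1, Real.sqrt_sq (norm_nonneg x)] at h
  refine h.congr_fderiv ?_
  rw [← Nat.cast_smul_eq_nsmul ℝ, smul_smul]
  congr 1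
  have := norm_ne_zero_iff.2 hx
  push_cast
  field_simp

theorem contDiffAt_norm_infty {x : Euc n} (hx : x ≠ 0) : ContDiffAt ℝ ∞ (fun y : Euc n => ‖y‖) x :=
  contDiffAt_norm ℝ hx

theorem ExtSetting.notMem_of_le_norm (S : ExtSetting n) {x : Euc n} (hx : S.R₀ ≤ ‖x‖) :
    x ∉ S.K := fun h => by
  have := S.hKR₀ h
  rw [mem_ball_zero_iff] at this
  linarith

theorem ExtSetting.ne_zero_of_le_norm (S : ExtSetting n) {x : Euc n} (hx : S.R₀ ≤ ‖x‖) :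
    x ≠ 0 := norm_pos_iff.1 (S.hR₀.trans_le hx)

theorem ExtSetting.contDiffAt_ul_sub_norm (S : ExtSetting n) {x : Euc n} (hx : S.R₀ ≤ ‖x‖) :
    ContDiffAt ℝ ∞ (fun y => S.ul y - ‖y‖) x :=
  (S.contDiffAt_ul (S.notMem_of_le_norm hx)).sub
    (contDiffAt_norm_infty (S.ne_zero_of_le_norm hx))

theorem ExtSetting.exists_cone_bounds (S : ExtSetting n) : ∃ C : ℝ, 0 < C ∧
    (∀ x ∈ (interior S.K)ᶜ, |S.ul x - ‖x‖| ≤ C) ∧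
    (∀ x, S.R₀ ≤ ‖x‖ → ‖fderiv ℝ (fun y => S.ul y - ‖y‖) x‖ ≤ C / ‖x‖) ∧
    (∀ x, S.R₀ ≤ ‖x‖ → ‖iteratedFDeriv ℝ 2 (fun y => S.ul y - ‖y‖) x‖
      + ‖iteratedFDeriv ℝ 3 S.ul x‖ ≤ C / ‖x‖ ^ 2) := by
  obtain ⟨C₀, h0⟩ := S.hulcone
  obtain ⟨C₁, hC₁, h1⟩ := exists_decay_of_eventually S.hR₀
    (fun x => ‖fderiv ℝ (fun y => S.ul y - ‖y‖) x‖) 1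
    (ContinuousOn.fderiv_of_contDiffAt fun x hx => S.contDiffAt_ul_sub_norm hx).norm
    (by simpa using S.huldec1)
  obtain ⟨C₂, hC₂, h2⟩ := exists_decay_of_eventually S.hR₀
    (fun x => ‖iteratedFDeriv ℝ 2 (fun y => S.ul y - ‖y‖) x‖ + ‖iteratedFDeriv ℝ 3 S.ul x‖) 2
    (fun x hx => by
      refine ContinuousWithinAt.add ?_ ?_
      · exact (((S.contDiffAt_ul_sub_norm hx).iteratedFDeriv_right (m := 0) (i := 2)
          (by simpa using WithTop.coe_le_coe.2 (le_top : (2 : ℕ∞) ≤ ⊤))).continuousAt.norm).continuousWithinAt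
      · exact (((S.contDiffAt_ul (S.notMem_of_le_norm hx)).iteratedFDeriv_right (m := 0) (i := 3)
          (by simpa using WithTop.coe_le_coe.2 (le_top : (3 : ℕ∞) ≤ ⊤))).continuousAt.norm).continuousWithinAt)
    S.huldec2
  refine ⟨max C₀ (max C₁ C₂), by positivity, fun x hx => (h0 x hx).trans (le_max_left _ _),
    fun x hx => ?_, fun x hx => ?_⟩
  · have hx0 := S.hR₀.trans_le hx
    have := h1 x hx
    rw [pow_one] at this
    refine this.trans ?_
    gcongr
    exact (le_max_left _ _).trans (le_max_right _ _)
  · have hx0 := S.hR₀.trans_le hx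
    refine (h2 x hx).trans ?_
    gcongr
    exact (le_max_right _ _).trans (le_max_right _ _)

/-- A ray from the origin leaves the obstacle for the last time through its boundary. -/
theorem ExtSetting.exists_last_exit (S : ExtSetting n) {e : Euc n} (he : ‖e‖ = 1) :
    ∃ s, 0 ≤ s ∧ s < S.R₀ ∧ s • e ∈ frontier S.K ∧ ∀ r, s < r → r • e ∉ S.K := by
  have hcont : Continuous fun r : ℝ => r • e := by fun_prop
  set T := Icc 0 S.R₀ ∩ (fun r : ℝ => r • e) ⁻¹' S.K
  have hT : IsCompact T := isCompact_Icc.inter_right (S.hKc.isClosed.preimage hcont)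
  have h0 : (0 : ℝ) ∈ T := ⟨⟨le_rfl, S.hR₀.le⟩, by simpa using interior_subset S.hK0⟩
  obtain ⟨s, hs, hmax⟩ := hT.exists_isMaxOn ⟨0, h0⟩ continuousOn_id
  have hout : ∀ r, s < r → r • e ∉ S.K := by
    intro r hr hrK
    have h1 : ‖r • e‖ < S.R₀ := by simpa using S.hKR₀ hrK
    rw [norm_smul, he, mul_one, Real.norm_of_nonneg (hs.1.1.trans hr.le)] at h1
    have : r ≤ s := hmax ⟨⟨hs.1.1.trans hr.le, h1.le⟩, hrK⟩
    linarith
  refine ⟨s, hs.1.1, ?_, ⟨subset_closure hs.2, fun hint => ?_⟩, hout⟩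
  · have h1 : ‖s • e‖ < S.R₀ := by simpa using S.hKR₀ hs.2
    rwa [norm_smul, he, mul_one, Real.norm_of_nonneg hs.1.1] at h1
  · have h1 : ∀ᶠ r in 𝓝 s, r • e ∈ S.K :=
      (hcont.tendsto s).eventually (mem_interior_iff_mem_nhds.1 hint)
    obtain ⟨r, hr, hsr⟩ := ((h1.filter_mono nhdsWithin_le_nhds).and
      (self_mem_nhdsWithin : Ioi s ∈ 𝓝[>] s)).exists
    exact hout r hsr hr

theorem mem_solDom_of_le_norm (S : ExtSetting n) {R : ℝ} {x : Euc n} (h1 : S.R₀ ≤ ‖x‖)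
    (h2 : ‖x‖ ≤ R) : x ∈ solDom S R :=
  ⟨by simpa using h2, fun h => S.notMem_of_le_norm h1 (interior_subset h)⟩

theorem mem_ball_diff_of_le_norm (S : ExtSetting n) {R : ℝ} {x : Euc n} (h1 : S.R₀ ≤ ‖x‖)
    (h2 : ‖x‖ < R) : x ∈ ball 0 R \ S.K :=
  ⟨by simpa using h2, S.notMem_of_le_norm h1⟩

theorem IsSol.convexOn_line {S : ExtSetting n} {R : ℝ} {u : Euc n → ℝ} (hu : IsSol S R u)
    {a v : Euc n} {l r : ℝ} (hI : ∀ s ∈ Icc l r, a + s • v ∈ solDom S R)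
    (hIo : ∀ s ∈ Ioo l r, a + s • v ∈ ball 0 R \ S.K) :
    ConvexOn ℝ (Icc l r) fun s => u (a + s • v) :=
  convexOn_comp_line hu.1.continuousOn (fun _ hx => hu.contDiffAt hx) hu.2.1 hI hIo

theorem norm_smul_unit {e : Euc n} (he : ‖e‖ = 1) {r : ℝ} (hr : 0 ≤ r) : ‖r • e‖ = r := by
  rw [norm_smul, he, mul_one, Real.norm_of_nonneg hr]

theorem IsSol.convexOn_ray {S : ExtSetting n} {R : ℝ} {u : Euc n → ℝ} (hu : IsSol S R u)
    {e : Euc n} (he : ‖e‖ = 1) : ConvexOn ℝ (Icc S.R₀ R) fun r => u (r • e) := by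
  have h := hu.convexOn_line (a := 0) (v := e) (l := S.R₀) (r := R)
    (fun s hs => by
      have := norm_smul_unit he (S.hR₀.le.trans hs.1)
      rw [zero_add]
      exact mem_solDom_of_le_norm S (by rw [this]; exact hs.1) (by rw [this]; exact hs.2))
    (fun s hs => by
      have := norm_smul_unit he (S.hR₀.le.trans hs.1.le)
      rw [zero_add]
      exact mem_ball_diff_of_le_norm S (by rw [this]; exact hs.1.le) (by rw [this]; exact hs.2))
  simpa using h

theorem exists_unit_smul {x : Euc n} (hx : x ≠ 0) : ∃ e : Euc n, ‖e‖ = 1 ∧ x = ‖x‖ • e := by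
  have := norm_ne_zero_iff.2 hx
  exact ⟨‖x‖⁻¹ • x, by rw [norm_smul, norm_inv, norm_norm, inv_mul_cancel₀ this],
    by rw [smul_smul, mul_inv_cancel₀ this, one_smul]⟩

theorem IsSol.le_norm_add {S : ExtSetting n} {R : ℝ} {u : Euc n → ℝ} (hu : IsSol S R u)
    {C : ℝ} (hC : ∀ x ∈ (interior S.K)ᶜ, |S.ul x - ‖x‖| ≤ C)
    {x : Euc n} (h1 : S.R₀ ≤ ‖x‖) (h2 : ‖x‖ ≤ R) : u x ≤ ‖x‖ + C := by
  obtain ⟨e, he, hxe⟩ := exists_unit_smul (S.ne_zero_of_le_norm h1)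
  obtain ⟨s, hs0, hsR, hsK, hout⟩ := S.exists_last_exit he
  have hsint : s • e ∉ interior S.K := hsK.2
  have hconv : ConvexOn ℝ (Icc s R) fun r => u (0 + r • e) := hu.convexOn_line
    (fun r hr => by
      rw [zero_add]
      refine ⟨by simpa [norm_smul_unit he (hs0.trans hr.1)] using hr.2, ?_⟩
      rcases hr.1.eq_or_lt with rfl | h
      · exact hsint
      · exact fun h' => hout r h (interior_subset h'))
    (fun r hr => by
      rw [zero_add]
      exact ⟨by simpa [norm_smul_unit he (hs0.trans hr.1.le)] using hr.2, hout r hr.1⟩)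
  simp only [zero_add] at hconv
  have hconv2 := hconv.sub (concaveOn_id (convex_Icc s R))
  have hsR' : s ≤ R := by linarith
  have h3 := hconv2.le_max_of_mem_Icc (left_mem_Icc.2 hsR') (right_mem_Icc.2 hsR')
    (z := ‖x‖) ⟨by linarith, h2⟩
  have hbd : ∀ r, 0 ≤ r → r • e ∉ interior S.K → u (r • e) = S.ul (r • e) →
      u (r • e) - r ≤ C := fun r hr hrK heq => by
    have h4 := (abs_le.1 (hC (r • e) hrK)).2
    rw [norm_smul_unit he hr] at h4
    rw [heq]; exact h4
  have h4 := hbd s hs0 hsint (hu.2.2.2 _ (Or.inr hsK))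
  have hR0 : 0 ≤ R := hs0.trans hsR'
  have h5 := hbd R hR0 (fun h => hout R (by linarith) (interior_subset h))
    (hu.2.2.2 _ (Or.inl (by simpa using norm_smul_unit he hR0)))
  simp only [Pi.sub_apply, id, ← hxe] at h3
  have := h3.trans (max_le h4 h5)
  linarith

/-- The tangent plane of a solution lies below it along segments. -/
theorem IsSol.fderiv_le_sub {S : ExtSetting n} {R : ℝ} {u : Euc n → ℝ} (hu : IsSol S R u)
    {x v : Euc n} (hx : x ∈ ball 0 R \ S.K)
    (h1 : ∀ s ∈ Icc (0 : ℝ) 1, x + s • v ∈ solDom S R)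
    (h2 : ∀ s ∈ Ioo (0 : ℝ) 1, x + s • v ∈ ball 0 R \ S.K) :
    fderiv ℝ u x v ≤ u (x + v) - u x := by
  have hconv := hu.convexOn_line h1 h2
  have hd : HasDerivAt (fun s : ℝ => u (x + s • v)) (fderiv ℝ u x v) 0 := by
    have := hasDerivAt_comp_line (w := u) (a := x) (v := v) (s := 0)
      (by simpa using (hu.contDiffAt hx).differentiableAt (by simp))
    simpa using this
  have h3 := hconv.le_slope_of_hasDerivAt (left_mem_Icc.2 zero_le_one)
    (right_mem_Icc.2 zero_le_one) zero_lt_one hd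
  simpa [slope_def_field] using h3

theorem ExtSetting.norm_fderiv_ul_sub_le (S : ExtSetting n) {x : Euc n} (hx : S.R₀ ≤ ‖x‖) :
    ‖fderiv ℝ S.ul x - ‖x‖⁻¹ • innerSL ℝ x‖ = ‖fderiv ℝ (fun y => S.ul y - ‖y‖) x‖ := by
  have h := ((S.contDiffAt_ul (S.notMem_of_le_norm hx)).differentiableAt
    (by simp)).hasFDerivAt.sub (hasFDerivAt_norm (S.ne_zero_of_le_norm hx))
  exact congrArg _ h.fderiv.symm

theorem ExtSetting.abs_ul_radial_sub_le (S : ExtSetting n) {C : ℝ} (hC0 : 0 ≤ C)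
    (hC : ∀ x, S.R₀ ≤ ‖x‖ → ‖fderiv ℝ (fun y => S.ul y - ‖y‖) x‖ ≤ C / ‖x‖)
    {e : Euc n} (he : ‖e‖ = 1) {r r' : ℝ} (hr : S.R₀ ≤ r) (hrr : r ≤ r') :
    |(S.ul (r' • e) - r') - (S.ul (r • e) - r)| ≤ C / r * (r' - r) := by
  have hr0 : 0 < r := S.hR₀.trans_le hr
  have h := (convex_Icc r r').norm_image_sub_le_of_norm_hasDerivWithin_le
    (f := fun s => S.ul (0 + s • e) - ‖(0 : Euc n) + s • e‖)
    (f' := fun s => fderiv ℝ (fun y => S.ul y - ‖y‖) (0 + s • e) e) (C := C / r)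
    (fun s hs => (hasDerivAt_comp_line (w := fun y => S.ul y - ‖y‖)
      ((S.contDiffAt_ul_sub_norm (by
        rw [zero_add, norm_smul_unit he (hr0.le.trans hs.1)]; exact hr.trans hs.1)).differentiableAt
        (by simp))).hasDerivWithinAt)
    (fun s hs => by
      have hn : ‖(0 : Euc n) + s • e‖ = s := by rw [zero_add, norm_smul_unit he (hr0.le.trans hs.1)]
      have h1 := hC (0 + s • e) (by rw [hn]; exact hr.trans hs.1)
      have h2 := (fderiv ℝ (fun y => S.ul y - ‖y‖) (0 + s • e)).le_opNorm e
      rw [he, mul_one] at h2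
      refine h2.trans (h1.trans ?_)
      rw [hn]
      have := hs.1
      gcongr)
    (left_mem_Icc.2 hrr) (right_mem_Icc.2 hrr)
  simpa [norm_smul_unit he hr0.le, norm_smul_unit he (hr0.le.trans hrr),
    Real.norm_of_nonneg (sub_nonneg.2 hrr)] using h

section
variable {S : ExtSetting n} {R C : ℝ} {u : Euc n → ℝ}

theorem IsSol.le_fderiv_radial (hu : IsSol S R u) (hC0 : 0 ≤ C)
    (hC : ∀ x ∈ (interior S.K)ᶜ, |S.ul x - ‖x‖| ≤ C) (hR : 4 * S.R₀ < R)
    {e : Euc n} (he : ‖e‖ = 1) {r : ℝ} (h1 : R / 2 ≤ r) (h2 : r < R) :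
    1 - 8 * C / R ≤ fderiv ℝ u (r • e) e := by
  have hR0 := S.hR₀
  have hr0 : 0 < r := by linarith
  have hnr := norm_smul_unit he hr0.le
  have hseg : ∀ s ∈ Icc (0 : ℝ) 1, S.R₀ ≤ ‖r • e + s • (-(r - S.R₀)) • e‖ ∧
      ‖r • e + s • (-(r - S.R₀)) • e‖ ≤ r := by
    intro s hs
    have : r • e + s • (-(r - S.R₀)) • e = (r - s * (r - S.R₀)) • e := by
      rw [smul_smul, ← add_smul]; ring_nf
    have h3 : s * (r - S.R₀) ≤ 1 * (r - S.R₀) := by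
      apply mul_le_mul_of_nonneg_right hs.2; linarith
    have h4 : 0 ≤ s * (r - S.R₀) := mul_nonneg hs.1 (by linarith)
    rw [this, norm_smul_unit he (by linarith)]
    constructor <;> linarith
  have h := hu.fderiv_le_sub (x := r • e) (v := (-(r - S.R₀)) • e)
    (mem_ball_diff_of_le_norm S (by rw [hnr]; linarith) (by rw [hnr]; exact h2))
    (fun s hs => mem_solDom_of_le_norm S (hseg s hs).1 ((hseg s hs).2.trans h2.le))
    (fun s hs => mem_ball_diff_of_le_norm S (hseg s (Ioo_subset_Icc_self hs)).1
      ((hseg s (Ioo_subset_Icc_self hs)).2.trans_lt h2))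
  have he0 : r • e + (-(r - S.R₀)) • e = S.R₀ • e := by rw [← add_smul]; ring_nf
  rw [he0, map_smul, smul_eq_mul] at h
  have hn0 := norm_smul_unit he hR0.le
  have h3 := hu.le_norm_add hC (x := S.R₀ • e) hn0.ge (by rw [hn0]; linarith)
  have h4 := hu.ul_le (mem_solDom_of_le_norm S (x := r • e) (by rw [hnr]; linarith)
    (by rw [hnr]; linarith))
  have h5 := (abs_le.1 (hC (r • e) fun h => S.notMem_of_le_norm (x := r • e)
    (by rw [hnr]; linarith) (interior_subset h))).1
  rw [hnr] at h5
  rw [hn0] at h3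
  set d := fderiv ℝ u (r • e) e
  have h6 : (r - S.R₀) * (1 - d) ≤ 2 * C := by linarith
  have hRp : 0 < R := by linarith
  by_contra! hlt
  have h7 : 8 * C / R < 1 - d := by linarith
  rw [div_lt_iff₀ hRp] at h7
  have h8 : 0 < 1 - d := by
    by_contra! h9
    nlinarith
  nlinarith

theorem IsSol.fderiv_radial_le (hu : IsSol S R u) (hC0 : 0 ≤ C)
    (hC : ∀ x, S.R₀ ≤ ‖x‖ → ‖fderiv ℝ (fun y => S.ul y - ‖y‖) x‖ ≤ C / ‖x‖) (hR : 4 * S.R₀ < R)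
    {e : Euc n} (he : ‖e‖ = 1) {r : ℝ} (h1 : R / 2 ≤ r) (h2 : r < R) :
    fderiv ℝ u (r • e) e ≤ 1 + 2 * C / R := by
  have hR0 := S.hR₀
  have hr0 : 0 < r := by linarith
  have hnr := norm_smul_unit he hr0.le
  have hseg : ∀ s ∈ Icc (0 : ℝ) 1, ‖r • e + s • (R - r) • e‖ = r + s * (R - r) := by
    intro s hs
    have : r • e + s • (R - r) • e = (r + s * (R - r)) • e := by
      rw [smul_smul, ← add_smul]
    have h4 : 0 ≤ s * (R - r) := mul_nonneg hs.1 (by linarith)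
    rw [this, norm_smul_unit he (by linarith)]
  have h := hu.fderiv_le_sub (x := r • e) (v := (R - r) • e)
    (mem_ball_diff_of_le_norm S (by rw [hnr]; linarith) (by rw [hnr]; exact h2))
    (fun s hs => by
      have h3 := hseg s hs
      have h4 : 0 ≤ s * (R - r) := mul_nonneg hs.1 (by linarith)
      have h5 : s * (R - r) ≤ 1 * (R - r) := by
        apply mul_le_mul_of_nonneg_right hs.2; linarith
      exact mem_solDom_of_le_norm S (by rw [h3]; linarith) (by rw [h3]; linarith))
    (fun s hs => by
      have h3 := hseg s (Ioo_subset_Icc_self hs)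
      have h4 : 0 ≤ s * (R - r) := mul_nonneg hs.1.le (by linarith)
      have h5 : s * (R - r) < 1 * (R - r) := by
        apply mul_lt_mul_of_pos_right hs.2; linarith
      exact mem_ball_diff_of_le_norm S (by rw [h3]; linarith) (by rw [h3]; linarith))
  have he0 : r • e + (R - r) • e = R • e := by rw [← add_smul]; ring_nf
  rw [he0, map_smul, smul_eq_mul] at h
  have hnR := norm_smul_unit he (show 0 ≤ R by linarith)
  have h3 := hu.2.2.2 (R • e) (Or.inl (by simpa using hnR))
  have h4 := hu.ul_le (mem_solDom_of_le_norm S (x := r • e) (by rw [hnr]; linarith)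
    (by rw [hnr]; linarith))
  have h5 := (abs_le.1 (S.abs_ul_radial_sub_le hC0 hC he (by linarith) h2.le)).2
  have h6 : C / r ≤ 2 * C / R := by
    rw [div_le_div_iff₀ hr0 (by linarith)]; nlinarith
  have h7 : C / r * (R - r) ≤ 2 * C / R * (R - r) :=
    mul_le_mul_of_nonneg_right h6 (by linarith)
  have h8 : (R - r) * fderiv ℝ u (r • e) e ≤ (R - r) * (1 + 2 * C / R) := by linarith
  exact le_of_mul_le_mul_left h8 (by linarith)

theorem IsSol.fderiv_tangential_le (hu : IsSol S R u)
    (hC : ∀ x ∈ (interior S.K)ᶜ, |S.ul x - ‖x‖| ≤ C)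
    (hR : 4 * S.R₀ < R) {x τ : Euc n} (h1 : R / 2 ≤ ‖x‖) (h2 : ‖x‖ < R)
    (hτ : ‖τ‖ = 1) (hxτ : ⟪x, τ⟫ = 0) {s : ℝ} (hs0 : 0 < s) (hs : s ≤ R / 8) :
    s * fderiv ℝ u x τ ≤ 2 * C + s ^ 2 / ‖x‖ ^ 2 * fderiv ℝ u x x := by
  have hR0 := S.hR₀
  set r := ‖x‖ with hr
  have hr0 : 0 < r := by linarith
  set v : Euc n := s • τ - (s ^ 2 / r ^ 2) • x with hv
  have hq : s ^ 2 / r ^ 2 ≤ 1 / 16 := by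
    rw [div_le_div_iff₀ (by positivity) (by norm_num)]
    nlinarith
  have hq0 : 0 ≤ s ^ 2 / r ^ 2 := by positivity
  have hnv : ‖v‖ < R / 4 := by
    have h3 : ‖v‖ ≤ s + s ^ 2 / r ^ 2 * r := by
      refine (norm_sub_le _ _).trans (le_of_eq ?_)
      rw [norm_smul, norm_smul, hτ, Real.norm_of_nonneg hs0.le, Real.norm_of_nonneg hq0, mul_one]
    nlinarith
  have hxv : ‖x + v‖ ≤ r := by
    refine le_of_sq_le_sq ?_ hr0.le
    have h3 : x + v = (1 - s ^ 2 / r ^ 2) • x + s • τ := by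
      rw [hv, sub_smul, one_smul]; abel
    rw [h3, norm_add_sq_real, norm_smul, norm_smul, inner_smul_left, inner_smul_right, hxτ, hτ,
      mul_pow, mul_pow, ← hr]
    simp only [Real.norm_eq_abs, sq_abs]
    have h4 : s ^ 2 / r ^ 2 * r ^ 2 = s ^ 2 := by field_simp
    nlinarith
  have hseg : ∀ σ ∈ Icc (0 : ℝ) 1, S.R₀ ≤ ‖x + σ • v‖ ∧ ‖x + σ • v‖ ≤ r := by
    intro σ hσ
    constructor
    · have h3 := norm_sub_le_norm_add x (σ • v)
      have h4 : ‖σ • v‖ ≤ 1 * ‖v‖ := by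
        rw [norm_smul, Real.norm_of_nonneg hσ.1]
        exact mul_le_mul_of_nonneg_right hσ.2 (norm_nonneg _)
      linarith
    · have h3 : x + σ • v = (1 - σ) • x + σ • (x + v) := by
        rw [sub_smul, one_smul, smul_add]; abel
      rw [h3]
      refine (norm_add_le _ _).trans ?_
      rw [norm_smul, norm_smul, Real.norm_of_nonneg hσ.1, Real.norm_of_nonneg (sub_nonneg.2 hσ.2)]
      have := mul_le_mul_of_nonneg_left hxv hσ.1
      linarith
  have h := hu.fderiv_le_sub (x := x) (v := v)
    (mem_ball_diff_of_le_norm S (by linarith) h2)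
    (fun s hs => mem_solDom_of_le_norm S (hseg s hs).1 ((hseg s hs).2.trans h2.le))
    (fun s hs => mem_ball_diff_of_le_norm S (hseg s (Ioo_subset_Icc_self hs)).1
      ((hseg s (Ioo_subset_Icc_self hs)).2.trans_lt h2))
  have h3 := hseg 1 ⟨zero_le_one, le_rfl⟩
  rw [one_smul] at h3
  have h4 := hu.le_norm_add hC h3.1 (h3.2.trans h2.le)
  have h5 := hu.ul_le (mem_solDom_of_le_norm S (x := x) (by linarith) (by linarith))
  have h6 := (abs_le.1 (hC x fun h => S.notMem_of_le_norm (x := x)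
    (by linarith) (interior_subset h))).1
  rw [hv, map_sub, map_smul, map_smul, smul_eq_mul, smul_eq_mul, ← hv] at h
  linarith

end

/-- On `R/2 ≤ |x| < R` the gradient of a solution is `O(R^{-1/2})`-close to the radial field. -/
theorem ExtSetting.exists_gradient_bound (S : ExtSetting n) : ∃ A : ℝ, 0 < A ∧
    ∀ R : ℝ, 4 * S.R₀ < R → ∀ u : Euc n → ℝ, IsSol S R u → ∀ x : Euc n, R / 2 ≤ ‖x‖ → ‖x‖ < R →
      ‖fderiv ℝ u x - ‖x‖⁻¹ • innerSL ℝ x‖ ≤ A / √R := by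
  obtain ⟨C, hC0, hCa, hCb, -⟩ := S.exists_cone_bounds
  have hR₀ := S.hR₀
  have hq0 : 0 < √S.R₀ := Real.sqrt_pos.2 hR₀
  set B := 8 * C / √S.R₀ + √S.R₀ / 2 * (1 + C / (2 * S.R₀)) with hB
  have hB0 : 0 < B := by positivity
  refine ⟨8 * C / √S.R₀ + 2 * B, by positivity, fun R hR u hu x h1 h2 => ?_⟩
  have hRp : 0 < R := by linarith
  have hsR : 0 < √R := Real.sqrt_pos.2 hRp
  have hsR2 : √R ^ 2 = R := Real.sq_sqrt hRp.le
  have hq2 : √S.R₀ ^ 2 = S.R₀ := Real.sq_sqrt hR₀.le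
  have hqR : √S.R₀ ≤ √R := Real.sqrt_le_sqrt (by linarith)
  have hqR2 : 2 * √S.R₀ ≤ √R := by
    refine le_of_sq_le_sq ?_ hsR.le
    rw [mul_pow, hq2, hsR2]; linarith
  have hx0 : x ≠ 0 := S.ne_zero_of_le_norm (by linarith)
  obtain ⟨e, he, hxe⟩ := exists_unit_smul hx0
  set r := ‖x‖ with hr
  have hr0 : 0 < r := by linarith
  have hrad1 : 1 - 8 * C / R ≤ fderiv ℝ u x e := by
    have := hu.le_fderiv_radial hC0.le hCa hR he h1 h2
    rwa [← hxe] at this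
  have hrad2 : fderiv ℝ u x e ≤ 1 + 2 * C / R := by
    have := hu.fderiv_radial_le hC0.le hCb hR he h1 h2
    rwa [← hxe] at this
  have hxx : fderiv ℝ u x x = r * fderiv ℝ u x e := by
    conv_lhs => rw [hxe, ← hxe]
    rw [← smul_eq_mul, ← map_smul, ← hxe]
  have hrad3 : |fderiv ℝ u x e - 1| ≤ 8 * C / √S.R₀ / √R := by
    have h3 : 8 * C / R ≤ 8 * C / √S.R₀ / √R := by
      rw [div_div]
      apply div_le_div_of_nonneg_left (by positivity) (by positivity)
      nlinarith
    have h4 : 2 * C / R ≤ 8 * C / R := by gcongr; linarith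
    rw [abs_le]; constructor <;> linarith
  have htan1 : ∀ τ : Euc n, ‖τ‖ = 1 → ⟪x, τ⟫ = 0 → fderiv ℝ u x τ ≤ B / √R := by
    intro τ hτ hxτ
    set s := √S.R₀ * √R / 4 with hs
    have hs0 : 0 < s := by positivity
    have h3 := hu.fderiv_tangential_le hCa hR h1 h2 hτ hxτ hs0 (by rw [hs]; nlinarith)
    rw [hxx, ← hr] at h3
    have h4 : s * fderiv ℝ u x τ ≤ s * (2 * C / s + s / r * (1 + C / (2 * S.R₀))) := by
      refine h3.trans ?_
      have h5 : s ^ 2 / r ^ 2 * (r * fderiv ℝ u x e) = s * (s / r * fderiv ℝ u x e) := by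
        field_simp
      have h6 : s * (2 * C / s) = 2 * C := by field_simp
      rw [h5, mul_add, h6]
      have h7 : 2 * C / R ≤ C / (2 * S.R₀) := by
        rw [div_le_div_iff₀ hRp (by positivity)]; nlinarith
      have h8 : fderiv ℝ u x e ≤ 1 + C / (2 * S.R₀) := by linarith
      gcongr
    have h5 := le_of_mul_le_mul_left h4 hs0
    have h6 : 2 * C / s = 8 * C / √S.R₀ / √R := by rw [hs]; field_simp; norm_num
    have h7 : s / r ≤ √S.R₀ / 2 / √R := by
      rw [div_le_div_iff₀ hr0 hsR, hs]
      nlinarith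
    have h8 : B / √R = 8 * C / √S.R₀ / √R + √S.R₀ / 2 / √R * (1 + C / (2 * S.R₀)) := by
      rw [hB]; ring
    rw [h8, ← h6]
    refine h5.trans ?_
    gcongr
  have htan : ∀ τ : Euc n, ⟪x, τ⟫ = 0 → |fderiv ℝ u x τ| ≤ B / √R * ‖τ‖ := by
    intro τ hxτ
    rcases eq_or_ne τ 0 with rfl | hτ0
    · simp
    obtain ⟨ε, hε, hτε⟩ := exists_unit_smul hτ0
    have hτ' : 0 < ‖τ‖ := norm_pos_iff.2 hτ0
    have hxε : ⟪x, ε⟫ = 0 := by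
      rw [hτε, inner_smul_right] at hxτ
      exact (mul_eq_zero.1 hxτ).resolve_left hτ'.ne'
    have h3 := htan1 ε hε hxε
    have h4 := htan1 (-ε) (by rwa [norm_neg]) (by rw [inner_neg_right, hxε, neg_zero])
    rw [map_neg] at h4
    have h5 : fderiv ℝ u x τ = ‖τ‖ * fderiv ℝ u x ε := by
      conv_lhs => rw [hτε]
      rw [map_smul, smul_eq_mul]
    rw [h5, abs_mul, abs_of_pos hτ', mul_comm]
    exact mul_le_mul_of_nonneg_right (abs_le.2 ⟨by linarith, h3⟩) hτ'.le
  refine ContinuousLinearMap.opNorm_le_bound _ (by positivity) fun h => ?_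
  set a := ⟪e, h⟫ with ha
  have hae : |a| ≤ ‖h‖ := by
    have := abs_real_inner_le_norm e h
    rwa [he, one_mul] at this
  have horth : ⟪x, h - a • e⟫ = 0 := by
    rw [hxe, inner_smul_left, inner_sub_right, inner_smul_right, real_inner_self_eq_norm_sq, he]
    simp [ha]
  have h3 := htan _ horth
  have h4 : ‖h - a • e‖ ≤ 2 * ‖h‖ := by
    refine (norm_sub_le _ _).trans ?_
    rw [norm_smul, he, mul_one, Real.norm_eq_abs]
    linarith
  have h5 : (fderiv ℝ u x - r⁻¹ • innerSL ℝ x) h =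
      fderiv ℝ u x (h - a • e) + a * (fderiv ℝ u x e - 1) := by
    have h6 : r⁻¹ * ⟪x, h⟫ = a := by
      conv_lhs => rw [hxe, inner_smul_left]
      simp only [conj_trivial]
      rw [ha]; field_simp
    simp only [_root_.sub_apply, _root_.smul_apply, innerSL_apply_apply, smul_eq_mul, h6,
      map_sub, map_smul]
    ring
  rw [h5, Real.norm_eq_abs]
  refine (abs_add_le _ _).trans ?_
  rw [abs_mul]
  calc |fderiv ℝ u x (h - a • e)| + |a| * |fderiv ℝ u x e - 1|
      ≤ B / √R * (2 * ‖h‖) + ‖h‖ * (8 * C / √S.R₀ / √R) := by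
        gcongr
        exact h3.trans (by gcongr)
    _ = (8 * C / √S.R₀ + 2 * B) / √R * ‖h‖ := by ring

section
variable {S : ExtSetting n} {R : ℝ} {u : Euc n → ℝ}

theorem pdW_solDom (w : Euc n → ℝ) {x : Euc n} (hx : x ∈ ball 0 R \ S.K) (i : Fin n) :
    pdW (solDom S R) w x i = partialDeriv i w x := by
  rw [pdW, fderivWithin_of_mem_nhds (solDom_mem_nhds S hx), partialDeriv]

theorem Tlin_solDom (t last : Fin n) (w : Euc n → ℝ) {x : Euc n} (hx : x ∈ ball 0 R \ S.K) :
    Tlin (solDom S R) R t last w x = partialDeriv t w x - x t / R * partialDeriv last w x := by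
  rw [Tlin, pdW_solDom w hx, pdW_solDom w hx]

theorem half_le_norm_of_mem_ball {last : Fin n} {δ : ℝ} (hR : 0 < R) (hδ : δ ≤ R / 2) {x : Euc n}
    (hx : x ∈ ball (EuclideanSpace.single last R) δ) : R / 2 ≤ ‖x‖ := by
  rw [mem_ball, dist_eq_norm, norm_sub_rev] at hx
  have h1 := norm_sub_norm_le (EuclideanSpace.single last R) x
  rw [PiLp.norm_single, Real.norm_of_nonneg hR.le] at h1
  linarith

theorem abs_apply_div_le_one {x : Euc n} (hR : 0 < R) (hx : ‖x‖ ≤ R) (t : Fin n) :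
    |x t / R| ≤ 1 := by
  rw [abs_div, abs_of_pos hR, div_le_one hR]
  exact (by simpa using PiLp.norm_apply_le x t : |x t| ≤ ‖x‖).trans hx

/-- Gradient bounds for a solution and for the subsolution near the outer boundary. -/
theorem ExtSetting.exists_gradient_sub_bound (S : ExtSetting n) : ∃ A : ℝ, 0 < A ∧
    ∀ R : ℝ, 4 * S.R₀ < R → ∀ u : Euc n → ℝ, IsSol S R u → ∀ x : Euc n, R / 2 ≤ ‖x‖ → ‖x‖ < R →
      ‖fderiv ℝ u x - fderiv ℝ S.ul x‖ ≤ A / √R ∧ ‖fderiv ℝ u x‖ ≤ A := by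
  obtain ⟨A, hA, hgrad⟩ := S.exists_gradient_bound
  obtain ⟨C, hC0, -, hC, -⟩ := S.exists_cone_bounds
  have hR₀ := S.hR₀
  have hq0 : 0 < √S.R₀ := Real.sqrt_pos.2 hR₀
  refine ⟨max (A + 2 * C / √S.R₀) (A / √S.R₀ + 1), by positivity, fun R hR u hu x h1 h2 => ?_⟩
  have hRp : 0 < R := by linarith
  have hsR : 0 < √R := Real.sqrt_pos.2 hRp
  have hsR2 : √R * √R = R := Real.mul_self_sqrt hRp.le
  have hqR : √S.R₀ ≤ √R := Real.sqrt_le_sqrt (by linarith)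
  have hxR : S.R₀ ≤ ‖x‖ := by linarith
  have hx0 : ‖x‖ ≠ 0 := by linarith
  have h3 := hgrad R hR u hu x h1 h2
  constructor
  · have h4 := hC x hxR
    rw [← S.norm_fderiv_ul_sub_le hxR] at h4
    have h5 : C / ‖x‖ ≤ 2 * C / √S.R₀ / √R := by
      rw [div_div, div_le_div_iff₀ (by positivity) (by positivity)]
      nlinarith [mul_le_mul_of_nonneg_right hqR hsR.le]
    have h6 : fderiv ℝ u x - fderiv ℝ S.ul x = (fderiv ℝ u x - ‖x‖⁻¹ • innerSL ℝ x) -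
        (fderiv ℝ S.ul x - ‖x‖⁻¹ • innerSL ℝ x) := by abel
    rw [h6]
    calc _ ≤ A / √R + 2 * C / √S.R₀ / √R := (norm_sub_le _ _).trans (add_le_add h3 (h4.trans h5))
      _ = (A + 2 * C / √S.R₀) / √R := by ring
      _ ≤ _ := by gcongr; exact le_max_left _ _
  · have h4 : ‖‖x‖⁻¹ • innerSL ℝ x‖ = 1 := by
      rw [norm_smul, innerSL_apply_norm, norm_inv, norm_norm, inv_mul_cancel₀ hx0]
    have h5 := norm_le_insert' (fderiv ℝ u x) (‖x‖⁻¹ • innerSL ℝ x)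
    have h6 : A / √R ≤ A / √S.R₀ := by gcongr
    exact le_max_of_le_right (by linarith)

theorem ExtSetting.exists_Tlin_interior_bound (S : ExtSetting n) (t last : Fin n) :
    ∃ c : ℝ, 0 < c ∧ ∀ R : ℝ, 4 * S.R₀ < R → ∀ u : Euc n → ℝ, IsSol S R u →
      ∀ x : Euc n, R / 2 ≤ ‖x‖ → ‖x‖ < R →
        |Tlin (solDom S R) R t last (fun y => u y - S.ul y) x| ≤ c / √R := by
  obtain ⟨A, hA, h⟩ := S.exists_gradient_sub_bound
  refine ⟨2 * A, by positivity, fun R hR u hu x h1 h2 => ?_⟩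
  have hR₀ := S.hR₀
  have hx : x ∈ ball 0 R \ S.K := mem_ball_diff_of_le_norm S (by linarith) h2
  have hD : fderiv ℝ (fun y => u y - S.ul y) x = fderiv ℝ u x - fderiv ℝ S.ul x :=
    fderiv_fun_sub ((hu.contDiffAt hx).differentiableAt (by simp))
      ((S.contDiffAt_ul hx.2).differentiableAt (by simp))
  have hb := (h R hR u hu x h1 h2).1
  rw [← hD] at hb
  rw [Tlin_solDom t last _ hx]
  have h3 := abs_partialDeriv_le (fun y => u y - S.ul y) x t
  have h4 := abs_partialDeriv_le (fun y => u y - S.ul y) x last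
  have h5 := abs_apply_div_le_one (by linarith) h2.le t
  calc _ ≤ |partialDeriv t (fun y => u y - S.ul y) x| +
        |x t / R| * |partialDeriv last (fun y => u y - S.ul y) x| := by
        rw [← abs_mul]; exact abs_sub _ _
    _ ≤ A / √R + 1 * (A / √R) := by
        gcongr
        · exact h3.trans hb
        · exact h4.trans hb
    _ = 2 * A / √R := by ring

theorem IsSol.sub_ul_radial_le {C : ℝ} (hu : IsSol S R u) (hC0 : 0 ≤ C)
    (hCa : ∀ x ∈ (interior S.K)ᶜ, |S.ul x - ‖x‖| ≤ C)
    (hCb : ∀ x, S.R₀ ≤ ‖x‖ → ‖fderiv ℝ (fun y => S.ul y - ‖y‖) x‖ ≤ C / ‖x‖)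
    (hR : 4 * S.R₀ < R) {x : Euc n} (h1 : R / 2 ≤ ‖x‖) (h2 : ‖x‖ ≤ R) :
    u x - S.ul x ≤ 6 * C / R * (R - ‖x‖) := by
  have hR₀ := S.hR₀
  have hRp : 0 < R := by linarith
  obtain ⟨e, he, hxe⟩ := exists_unit_smul (S.ne_zero_of_le_norm (x := x) (by linarith))
  set r := ‖x‖ with hr
  have hr0 : 0 < r := by linarith
  have hconv := (hu.convexOn_ray he).sub (concaveOn_id (convex_Icc S.R₀ R))
  have hd : 0 < R - S.R₀ := by linarith
  have h3 := hconv.2 (left_mem_Icc.2 (by linarith)) (right_mem_Icc.2 (by linarith))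
    (div_nonneg (show 0 ≤ R - r by linarith) hd.le)
    (div_nonneg (show 0 ≤ r - S.R₀ by linarith) hd.le) (by field_simp; ring)
  have hcomb : (R - r) / (R - S.R₀) * S.R₀ + (r - S.R₀) / (R - S.R₀) * R = r := by
    field_simp; ring
  simp only [Pi.sub_apply, id, smul_eq_mul, hcomb] at h3
  have hn0 := norm_smul_unit he hR₀.le
  have hnR := norm_smul_unit he hRp.le
  have h4 := hu.le_norm_add hCa (x := S.R₀ • e) hn0.ge (by rw [hn0]; linarith)
  rw [hn0] at h4
  have h5 := hu.2.2.2 (R • e) (Or.inl (by simpa using hnR))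
  have h6 := (abs_le.1 (hCa (R • e) fun h => S.notMem_of_le_norm (x := R • e)
    (by rw [hnR]; linarith) (interior_subset h))).1
  rw [hnR] at h6
  have h7 := (abs_le.1 (S.abs_ul_radial_sub_le hC0 hCb he (r := r) (by linarith) h2)).2
  have h8 : C / r ≤ 2 * C / R := by
    rw [div_le_div_iff₀ hr0 hRp]; nlinarith
  have h9 : C / r * (R - r) ≤ 2 * C / R * (R - r) :=
    mul_le_mul_of_nonneg_right h8 (by linarith)
  rw [h5] at h3
  have h10 : (r - S.R₀) / (R - S.R₀) = 1 - (R - r) / (R - S.R₀) := by field_simp; ring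
  have h11 : (R - r) / (R - S.R₀) ≤ 2 / R * (R - r) := by
    rw [div_mul_eq_mul_div, div_le_div_iff₀ hd hRp]; nlinarith
  have h12 : 0 ≤ (R - r) / (R - S.R₀) := div_nonneg (by linarith) hd.le
  rw [h10] at h3
  have h13 : (R - r) / (R - S.R₀) * ((u (S.R₀ • e) - S.R₀) - (S.ul (R • e) - R)) ≤
      2 / R * (R - r) * (2 * C) :=
    (mul_le_mul_of_nonneg_left (by linarith) h12).trans
      (mul_le_mul_of_nonneg_right h11 (by linarith))
  rw [← hxe] at h3 h7
  have h14 : 6 * C / R * (R - r) = 2 / R * (R - r) * (2 * C) + 2 * C / R * (R - r) := by ring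
  rw [h14]
  linarith

theorem IsSol.differentiableWithinAt_sub_ul (hu : IsSol S R u) {x : Euc n} (hx : x ∈ solDom S R) :
    DifferentiableWithinAt ℝ (fun y => u y - S.ul y) (solDom S R) x :=
  ((hu.1 x hx).differentiableWithinAt (by simp)).sub
    (((S.hulsm.mono (S.solDom_subset R)) x hx).differentiableWithinAt (by simp))

theorem IsSol.fderivWithin_sub_ul_inward {C : ℝ} (hu : IsSol S R u) (hC0 : 0 ≤ C)
    (hCa : ∀ x ∈ (interior S.K)ᶜ, |S.ul x - ‖x‖| ≤ C)
    (hCb : ∀ x, S.R₀ ≤ ‖x‖ → ‖fderiv ℝ (fun y => S.ul y - ‖y‖) x‖ ≤ C / ‖x‖)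
    (hR : 4 * S.R₀ < R) {x h : Euc n} (hx : ‖x‖ = R) (hh : ⟪x, h⟫ < 0) :
    0 ≤ fderivWithin ℝ (fun y => u y - S.ul y) (solDom S R) x h ∧
    fderivWithin ℝ (fun y => u y - S.ul y) (solDom S R) x h ≤ 6 * C / R ^ 2 * -⟪x, h⟫ := by
  have hR₀ := S.hR₀
  have hRp : 0 < R := by linarith
  have hx0 : x ≠ 0 := S.ne_zero_of_le_norm (x := x) (by linarith)
  have hxD : x ∈ solDom S R := mem_solDom_of_le_norm S (by linarith) hx.le
  have hN : HasDerivAt (fun s : ℝ => ‖x + s • h‖) (‖x‖⁻¹ * ⟪x, h⟫) 0 := by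
    have h1 : HasFDerivAt (fun y : Euc n => ‖y‖) (‖x‖⁻¹ • innerSL ℝ x) (x + (0 : ℝ) • h) := by
      simpa using hasFDerivAt_norm hx0
    exact h1.comp_hasDerivAt (0 : ℝ) (hasDerivAt_line x h 0)
  have hcont : Tendsto (fun s : ℝ => ‖x + s • h‖) (𝓝[>] 0) (𝓝 R) := by
    have := hN.continuousAt.tendsto
    simp only [zero_smul, add_zero, hx] at this
    exact this.mono_left nhdsWithin_le_nhds
  have hNs := (hasDerivWithinAt_iff_tendsto_slope' (s := Ioi 0) (by simp)).1
    hN.hasDerivWithinAt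
  have hneg : ‖x‖⁻¹ * ⟪x, h⟫ < 0 := mul_neg_of_pos_of_neg (by rw [hx]; positivity) hh
  have hev : ∀ᶠ s : ℝ in 𝓝[>] 0, R / 2 ≤ ‖x + s • h‖ ∧ ‖x + s • h‖ ≤ R := by
    filter_upwards [hcont.eventually (lt_mem_nhds (show R / 2 < R by linarith)),
      hNs.eventually (gt_mem_nhds hneg), self_mem_nhdsWithin] with s h1 h2 h3
    refine ⟨h1.le, ?_⟩
    rw [slope_def_field, div_neg_iff] at h2
    simp only [zero_smul, add_zero, hx, sub_zero] at h2
    have h3 : 0 < s := h3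
    rcases h2 with h2 | h2 <;> linarith
  have hwN : HasDerivWithinAt (fun s : ℝ => u (x + s • h) - S.ul (x + s • h))
      (fderivWithin ℝ (fun y => u y - S.ul y) (solDom S R) x h) (Ioi 0) 0 := by
    have h1 : HasFDerivWithinAt (fun y => u y - S.ul y)
        (fderivWithin ℝ (fun y => u y - S.ul y) (solDom S R) x) (solDom S R) (x + (0 : ℝ) • h) := by
      simpa using (hu.differentiableWithinAt_sub_ul hxD).hasFDerivWithinAt
    have h2 := h1.comp_hasDerivWithinAt (0 : ℝ)
      (s := (fun s : ℝ => x + s • h) ⁻¹' solDom S R) (hasDerivAt_line x h 0).hasDerivWithinAt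
      (mapsTo_preimage _ _)
    refine h2.mono_of_mem_nhdsWithin ?_
    filter_upwards [hev] with s hs
    exact mem_solDom_of_le_norm S (by linarith) hs.2
  have hws := (hasDerivWithinAt_iff_tendsto_slope' (s := Ioi 0) (by simp)).1 hwN
  have hux : u x - S.ul x = 0 := by
    rw [hu.2.2.2 x (Or.inl (by simpa using hx)), sub_self]
  constructor
  · refine ge_of_tendsto hws ?_
    filter_upwards [hev, self_mem_nhdsWithin] with s hs hs0
    have hs0 : 0 < s := hs0
    rw [slope_def_field]
    simp only [zero_smul, add_zero, hux, sub_zero]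
    have := hu.ul_le (mem_solDom_of_le_norm S (x := x + s • h) (by linarith) hs.2)
    exact div_nonneg (by linarith) hs0.le
  · have h1 := hNs.const_mul (-(6 * C / R))
    have h2 : -(6 * C / R) * (‖x‖⁻¹ * ⟪x, h⟫) = 6 * C / R ^ 2 * -⟪x, h⟫ := by
      rw [hx]; field_simp
    rw [h2] at h1
    refine le_of_tendsto_of_tendsto hws h1 ?_
    filter_upwards [hev, self_mem_nhdsWithin] with s hs hs0
    have hs0 : 0 < s := hs0
    rw [slope_def_field, slope_def_field]
    simp only [zero_smul, add_zero, hux, sub_zero, hx]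
    have h3 := hu.sub_ul_radial_le hC0 hCa hCb hR hs.1 hs.2
    rw [← mul_div_assoc]
    gcongr
    linarith

theorem IsSol.abs_fderivWithin_sub_ul_le {C : ℝ} (hu : IsSol S R u) (hC0 : 0 ≤ C)
    (hCa : ∀ x ∈ (interior S.K)ᶜ, |S.ul x - ‖x‖| ≤ C)
    (hCb : ∀ x, S.R₀ ≤ ‖x‖ → ‖fderiv ℝ (fun y => S.ul y - ‖y‖) x‖ ≤ C / ‖x‖)
    (hR : 4 * S.R₀ < R) {x : Euc n} (hx : ‖x‖ = R) (v : Euc n) :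
    |fderivWithin ℝ (fun y => u y - S.ul y) (solDom S R) x v| ≤ 6 * C / R ^ 2 * |⟪x, v⟫| := by
  have hR₀ := S.hR₀
  have hRp : 0 < R := by linarith
  set ℓ := fderivWithin ℝ (fun y => u y - S.ul y) (solDom S R) x
  have key : ∀ h : Euc n, ⟪x, h⟫ ≤ 0 → |ℓ h| ≤ 6 * C / R ^ 2 * |⟪x, h⟫| := by
    intro h hh
    have hc : Continuous fun ε : ℝ => h - ε • x := by fun_prop
    have ht : Tendsto (fun ε : ℝ => h - ε • x) (𝓝[>] 0) (𝓝 h) := by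
      simpa using (hc.tendsto 0).mono_left nhdsWithin_le_nhds
    have h1 : Tendsto (fun ε : ℝ => |ℓ (h - ε • x)|) (𝓝[>] 0) (𝓝 |ℓ h|) :=
      ((ℓ.continuous.abs).tendsto h).comp ht
    have h2 : Tendsto (fun ε : ℝ => 6 * C / R ^ 2 * |⟪x, h - ε • x⟫|) (𝓝[>] 0)
        (𝓝 (6 * C / R ^ 2 * |⟪x, h⟫|)) :=
      ((show Continuous fun h : Euc n => 6 * C / R ^ 2 * |⟪x, h⟫| by fun_prop).tendsto h).comp ht
    refine le_of_tendsto_of_tendsto h1 h2 ?_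
    filter_upwards [self_mem_nhdsWithin] with ε hε
    have hε : 0 < ε := hε
    have hneg : ⟪x, h - ε • x⟫ < 0 := by
      rw [inner_sub_right, inner_smul_right, real_inner_self_eq_norm_sq, hx]
      have : 0 < ε * R ^ 2 := by positivity
      linarith
    obtain ⟨h3, h4⟩ := hu.fderivWithin_sub_ul_inward hC0 hCa hCb hR hx hneg
    rw [abs_of_neg hneg, abs_of_nonneg h3]
    exact h4
  rcases le_total ⟪x, v⟫ 0 with h | h
  · exact key v h
  · have := key (-v) (by rw [inner_neg_right]; linarith)
    rwa [map_neg, abs_neg, inner_neg_right, abs_neg] at this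

end

theorem ExtSetting.exists_Tlin_sphere_bound (S : ExtSetting n) (t last : Fin n) :
    ∃ c : ℝ, 0 < c ∧ ∀ R : ℝ, 4 * S.R₀ < R → ∀ u : Euc n → ℝ, IsSol S R u →
      ∀ x ∈ sphere (0 : Euc n) R,
        |Tlin (solDom S R) R t last (fun y => u y - S.ul y) x| ≤
          c / R ^ 2 * ‖x - EuclideanSpace.single last R‖ ^ 2 := by
  obtain ⟨C, hC0, hCa, hCb, -⟩ := S.exists_cone_bounds
  have hR₀ := S.hR₀
  refine ⟨3 * C / S.R₀, by positivity, fun R hR u hu x hx => ?_⟩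
  have hRp : 0 < R := by linarith
  have hx : ‖x‖ = R := by simpa using hx
  have h1 := hu.abs_fderivWithin_sub_ul_le hC0.le hCa hCb hR hx
    (EuclideanSpace.single t 1 - (x t / R) • EuclideanSpace.single last 1)
  rw [map_sub, map_smul, smul_eq_mul] at h1
  refine h1.trans ?_
  have h2 : ⟪x, EuclideanSpace.single t 1 - (x t / R) • EuclideanSpace.single last 1⟫ =
      x t / R * (R - x last) := by
    rw [inner_sub_right, inner_smul_right, EuclideanSpace.inner_single_right,
      EuclideanSpace.inner_single_right]
    simp only [conj_trivial, one_mul]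
    field_simp
  have h3 : ‖x - EuclideanSpace.single last R‖ ^ 2 = 2 * R * (R - x last) := by
    rw [norm_sub_sq_real, hx, PiLp.norm_single, Real.norm_of_nonneg hRp.le,
      EuclideanSpace.inner_single_right]
    simp only [conj_trivial]
    ring
  have h4 : 0 ≤ R - x last := by
    have : |x last| ≤ ‖x‖ := by simpa using PiLp.norm_apply_le x last
    have := le_abs_self (x last)
    linarith
  have h5 := abs_apply_div_le_one hRp hx.le t
  rw [h2, h3, abs_mul, abs_of_nonneg h4]
  calc 6 * C / R ^ 2 * (|x t / R| * (R - x last))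
      ≤ 6 * C / R ^ 2 * (R / S.R₀ * (R - x last)) := by
        gcongr
        refine h5.trans ?_
        rw [one_le_div hR₀]; linarith
    _ = _ := by ring

theorem partialDeriv_mul {w v : Euc n → ℝ} {x : Euc n} (hw : DifferentiableAt ℝ w x)
    (hv : DifferentiableAt ℝ v x) (i : Fin n) :
    partialDeriv i (fun y => w y * v y) x =
      w x * partialDeriv i v x + partialDeriv i w x * v x := by
  simp only [partialDeriv, fderiv_fun_mul hw hv, _root_.add_apply, _root_.smul_apply, smul_eq_mul]
  ring

theorem partialDeriv_add {w v : Euc n → ℝ} {x : Euc n} (hw : DifferentiableAt ℝ w x)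
    (hv : DifferentiableAt ℝ v x) (i : Fin n) :
    partialDeriv i (fun y => w y + v y) x = partialDeriv i w x + partialDeriv i v x := by
  simp only [partialDeriv, fderiv_fun_add hw hv, _root_.add_apply]

theorem partialDeriv_const_mul (c : ℝ) {v : Euc n → ℝ} {x : Euc n}
    (hv : DifferentiableAt ℝ v x) (i : Fin n) :
    partialDeriv i (fun y => c * v y) x = c * partialDeriv i v x := by
  simp only [partialDeriv, fderiv_const_mul hv, _root_.smul_apply, smul_eq_mul]

theorem partialDeriv_coord_div (R : ℝ) (t i : Fin n) (x : Euc n) :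
    partialDeriv i (fun y : Euc n => y t / R) x = if i = t then 1 / R else 0 := by
  have h : HasFDerivAt (fun y : Euc n => y t / R)
      (R⁻¹ • (EuclideanSpace.proj t : Euc n →L[ℝ] ℝ)) x := by
    simpa [div_eq_inv_mul] using
      ((EuclideanSpace.proj t : Euc n →L[ℝ] ℝ).hasFDerivAt (x := x)).const_mul R⁻¹
  rw [partialDeriv, h.fderiv]
  simp [eq_comm]

theorem contDiff_coord_div (R : ℝ) (t : Fin n) : ContDiff ℝ ∞ (fun y : Euc n => y t / R) := by
  fun_prop

theorem partialDeriv_coord_mul {R : ℝ} {v : Euc n → ℝ} {x : Euc n}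
    (hv : DifferentiableAt ℝ v x) (t i : Fin n) :
    partialDeriv i (fun y => y t / R * v y) x =
      x t / R * partialDeriv i v x + if i = t then v x / R else 0 := by
  rw [partialDeriv_mul (((contDiff_coord_div R t).contDiffAt).differentiableAt (by simp)) hv,
    partialDeriv_coord_div]
  split_ifs <;> ring

theorem partialDeriv_partialDeriv_coord_mul {R : ℝ} {v : Euc n → ℝ} {x : Euc n}
    (hv : ∀ᶠ y in 𝓝 x, ContDiffAt ℝ ∞ v y) (t i j : Fin n) :
    partialDeriv i (partialDeriv j (fun y => y t / R * v y)) x =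
      x t / R * partialDeriv i (partialDeriv j v) x + (if i = t then partialDeriv j v x / R else 0)
        + if j = t then partialDeriv i v x / R else 0 := by
  have h : partialDeriv j (fun y => y t / R * v y) =ᶠ[𝓝 x]
      fun y => y t / R * partialDeriv j v y + (if j = t then 1 / R else 0) * v y := by
    filter_upwards [hv] with y hy
    rw [partialDeriv_coord_mul (hy.differentiableAt (by simp))]
    split_ifs <;> ring
  rw [(h.partialDeriv i).eq_of_nhds]
  have hvx := hv.self_of_nhds
  have hvd : DifferentiableAt ℝ v x := hvx.differentiableAt (by simp)
  have hpd : DifferentiableAt ℝ (partialDeriv j v) x :=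
    (hvx.partialDeriv j).differentiableAt (by simp)
  have hcd : DifferentiableAt ℝ (fun y : Euc n => y t / R) x :=
    ((contDiff_coord_div R t).contDiffAt).differentiableAt (by simp)
  rw [partialDeriv_add (hcd.fun_mul hpd) (hvd.const_mul _), partialDeriv_const_mul _ hvd,
    partialDeriv_coord_mul hpd]
  split_ifs <;> ring

/-- The linearized operator written with full derivatives. -/
def linOp (u w : Euc n → ℝ) (x : Euc n) : ℝ :=
  (∑ i, ∑ j, (Hess u x)⁻¹ i j * partialDeriv i (partialDeriv j w) x) -
    ((n : ℝ) + 2) / (1 + ∑ i, partialDeriv i u x ^ 2) *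
      ∑ i, partialDeriv i u x * partialDeriv i w x

/-- The tangential operator written with full derivatives. -/
def tangOp (R : ℝ) (t last : Fin n) (w : Euc n → ℝ) (x : Euc n) : ℝ :=
  partialDeriv t w x - x t / R * partialDeriv last w x

theorem partialDeriv_partialDeriv_sub {w v : Euc n → ℝ} {x : Euc n}
    (hw : ∀ᶠ y in 𝓝 x, ContDiffAt ℝ ∞ w y) (hv : ∀ᶠ y in 𝓝 x, ContDiffAt ℝ ∞ v y) (i j : Fin n) :
    partialDeriv i (partialDeriv j (fun y => w y - v y)) x =
      partialDeriv i (partialDeriv j w) x - partialDeriv i (partialDeriv j v) x := by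
  have h : partialDeriv j (fun y => w y - v y) =ᶠ[𝓝 x]
      fun y => partialDeriv j w y - partialDeriv j v y := by
    filter_upwards [hw, hv] with y h1 h2
    exact partialDeriv_sub (h1.differentiableAt (by simp)) (h2.differentiableAt (by simp)) j
  rw [(h.partialDeriv i).eq_of_nhds]
  exact partialDeriv_sub ((hw.self_of_nhds.partialDeriv j).differentiableAt (by simp))
    ((hv.self_of_nhds.partialDeriv j).differentiableAt (by simp)) i

theorem linOp_sub (u : Euc n → ℝ) {w v : Euc n → ℝ} {x : Euc n}
    (hw : ∀ᶠ y in 𝓝 x, ContDiffAt ℝ ∞ w y) (hv : ∀ᶠ y in 𝓝 x, ContDiffAt ℝ ∞ v y) :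
    linOp u (fun y => w y - v y) x = linOp u w x - linOp u v x := by
  have h3 : ∀ i, partialDeriv i (fun y => w y - v y) x =
      partialDeriv i w x - partialDeriv i v x := fun i =>
    partialDeriv_sub (hw.self_of_nhds.differentiableAt (by simp))
      (hv.self_of_nhds.differentiableAt (by simp)) i
  simp only [linOp, partialDeriv_partialDeriv_sub hw hv, h3, mul_sub, Finset.sum_sub_distrib]
  ring

theorem linOp_congr (u : Euc n → ℝ) {w v : Euc n → ℝ} {x : Euc n} (h : w =ᶠ[𝓝 x] v) :
    linOp u w x = linOp u v x := by
  simp only [linOp, fun i j => ((h.partialDeriv j).partialDeriv i).eq_of_nhds,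
    fun i => (h.partialDeriv i).eq_of_nhds]

theorem linOp_coord_mul {R : ℝ} (u : Euc n → ℝ) {v : Euc n → ℝ} {x : Euc n}
    (hv : ∀ᶠ y in 𝓝 x, ContDiffAt ℝ ∞ v y) (t : Fin n) :
    linOp u (fun y => y t / R * v y) x = x t / R * linOp u v x +
      (∑ j, (Hess u x)⁻¹ t j * partialDeriv j v x) / R +
      (∑ i, (Hess u x)⁻¹ i t * partialDeriv i v x) / R -
      ((n : ℝ) + 2) / (1 + ∑ i, partialDeriv i u x ^ 2) * (partialDeriv t u x * v x / R) := by
  have h1 : ∀ i, partialDeriv i (fun y => y t / R * v y) x =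
      x t / R * partialDeriv i v x + if i = t then v x / R else 0 := fun i =>
    partialDeriv_coord_mul (hv.self_of_nhds.differentiableAt (by simp)) t i
  simp only [linOp, partialDeriv_partialDeriv_coord_mul hv t, h1, mul_add, mul_ite, mul_zero,
    Finset.sum_add_distrib, Finset.sum_ite_eq', Finset.mem_univ, if_true]
  rw [Finset.sum_comm (f := fun i j => if i = t then _ else _)]
  simp only [Finset.sum_ite_eq', Finset.mem_univ, if_true, Finset.mul_sum, Finset.sum_div,
    mul_sub, mul_div_assoc]
  rw [show (∑ i, ∑ j, (Hess u x)⁻¹ i j * (x t / R * partialDeriv i (partialDeriv j v) x)) =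
    ∑ i, ∑ j, x t / R * ((Hess u x)⁻¹ i j * partialDeriv i (partialDeriv j v) x) from
    Finset.sum_congr rfl fun i _ => Finset.sum_congr rfl fun j _ => by ring]
  rw [show (∑ i, ((n : ℝ) + 2) / (1 + ∑ i, partialDeriv i u x ^ 2) *
      (partialDeriv i u x * (x t / R * partialDeriv i v x))) =
      ∑ i, x t / R * (((n : ℝ) + 2) / (1 + ∑ i, partialDeriv i u x ^ 2) *
      (partialDeriv i u x * partialDeriv i v x)) from
    Finset.sum_congr rfl fun i _ => by ring]
  ring

theorem ContDiffAt.hasFDerivAt_partialDeriv {w : Euc n → ℝ} {x : Euc n} (hw : ContDiffAt ℝ ∞ w x)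
    (i : Fin n) : HasFDerivAt (_root_.partialDeriv i w) (fderiv ℝ (_root_.partialDeriv i w) x) x :=
  ((hw.partialDeriv i).differentiableAt (by simp)).hasFDerivAt

section
variable {S : ExtSetting n} {R : ℝ} {u : Euc n → ℝ}

theorem IsSol.eventually_contDiffAt (hu : IsSol S R u) {x : Euc n} (hx : x ∈ ball 0 R \ S.K) :
    ∀ᶠ y in 𝓝 x, ContDiffAt ℝ ∞ u y := by
  filter_upwards [(isOpen_ball_diff S R).mem_nhds hx] with y hy using hu.contDiffAt hy

theorem ExtSetting.eventually_contDiffAt_ul (S : ExtSetting n) {x : Euc n} (hx : x ∉ S.K) :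
    ∀ᶠ y in 𝓝 x, ContDiffAt ℝ ∞ S.ul y := by
  filter_upwards [S.hKc.isClosed.isOpen_compl.mem_nhds hx] with y hy using S.contDiffAt_ul hy

theorem ExtSetting.domain_mem_nhds (S : ExtSetting n) {x : Euc n} (hx : x ∉ S.K) (z : ℝ) :
    (interior S.K)ᶜ ×ˢ (univ : Set ℝ) ∈ 𝓝 (x, z) :=
  prod_mem_nhds (mem_of_superset (S.hKc.isClosed.isOpen_compl.mem_nhds hx)
    (compl_subset_compl.2 interior_subset)) univ_mem

/-- The logarithm of the right-hand side along a solution has gradient bounded in terms of `Du`. -/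
theorem ExtSetting.exists_rhs_bound (S : ExtSetting n) : ∃ C : ℝ, 0 ≤ C ∧
    ∀ (w : Euc n → ℝ) (x : Euc n), x ∉ S.K → ContDiffAt ℝ ∞ w x →
      DifferentiableAt ℝ (fun y => S.f y (w y)) x ∧
      ∀ k, |partialDeriv k (fun y => S.f y (w y)) x| ≤
        C * (1 + ‖fderiv ℝ w x‖) * S.f x (w x) := by
  obtain ⟨C, hC⟩ := S.hfder
  refine ⟨max C 0, le_max_right _ _, fun w x hx hw => ?_⟩
  have hxi : x ∈ (interior S.K)ᶜ := fun h => hx (interior_subset h)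
  have hnh := S.domain_mem_nhds hx (w x)
  have hf0 := S.hfpos x hxi (w x)
  have hfd : HasFDerivAt (fun p : Euc n × ℝ => S.f p.1 p.2)
      (fderiv ℝ (fun p : Euc n × ℝ => S.f p.1 p.2) (x, w x)) (x, w x) :=
    ((S.hfsm.contDiffAt hnh).differentiableAt (by simp)).hasFDerivAt
  have hwd := (hw.differentiableAt (by simp)).hasFDerivAt
  have hcomp : HasFDerivAt (fun y => S.f y (w y))
      ((fderiv ℝ (fun p : Euc n × ℝ => S.f p.1 p.2) (x, w x)).comp
        ((ContinuousLinearMap.id ℝ (Euc n)).prod (fderiv ℝ w x))) x :=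
    HasFDerivAt.comp x (f := fun y => (y, w y)) hfd ((hasFDerivAt_id x).prodMk hwd)
  refine ⟨hcomp.differentiableAt, fun k => ?_⟩
  have h1 := hC (x, w x) ⟨hxi, mem_univ _⟩
  rw [fderivWithin_of_mem_nhds hnh] at h1
  have h2 : ‖fderiv ℝ (fun p : Euc n × ℝ => S.f p.1 p.2) (x, w x)‖ ≤ max C 0 * S.f x (w x) := by
    have h3 : C * S.f x (w x) ≤ max C 0 * S.f x (w x) :=
      mul_le_mul_of_nonneg_right (le_max_left _ _) hf0.le
    have h4 := norm_nonneg (iteratedFDerivWithin ℝ 2 (fun q : Euc n × ℝ => S.f q.1 q.2)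
      ((interior S.K)ᶜ ×ˢ univ) (x, w x))
    simp only at h1
    linarith
  rw [partialDeriv, hcomp.fderiv, ContinuousLinearMap.comp_apply]
  have h5 := (fderiv ℝ (fun p : Euc n × ℝ => S.f p.1 p.2) (x, w x)).le_opNorm
    (((ContinuousLinearMap.id ℝ (Euc n)).prod (fderiv ℝ w x)) (EuclideanSpace.single k 1))
  have h6 : ‖((ContinuousLinearMap.id ℝ (Euc n)).prod (fderiv ℝ w x))
      (EuclideanSpace.single k 1)‖ ≤ 1 + ‖fderiv ℝ w x‖ := by
    rw [ContinuousLinearMap.prod_apply, Prod.norm_def]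
    have h7 := abs_partialDeriv_le w x k
    have h8 := norm_nonneg (fderiv ℝ w x)
    refine max_le ?_ ?_
    · simp
    · have : ‖fderiv ℝ w x (EuclideanSpace.single k 1)‖ ≤ ‖fderiv ℝ w x‖ := h7
      linarith
  calc _ ≤ _ := h5
    _ ≤ (max C 0 * S.f x (w x)) * (1 + ‖fderiv ℝ w x‖) := by gcongr
    _ = _ := by ring

/-- The equation for `u`, differentiated in the `k`-th direction. -/
theorem IsSol.linOp_partialDeriv (hu : IsSol S R u) {x : Euc n} (hx : x ∈ ball 0 R \ S.K)
    (k : Fin n) :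
    linOp u (partialDeriv k u) x = partialDeriv k (fun y => S.f y (u y)) x / S.f x (u x) := by
  have hux := hu.contDiffAt hx
  have hev := hu.eventually_contDiffAt hx
  have hfd : HasFDerivAt (fun y => S.f y (u y)) (fderiv ℝ (fun y => S.f y (u y)) x) x := by
    obtain ⟨C, -, hC⟩ := S.exists_rhs_bound
    exact (hC u x hx.2 hux).1.hasFDerivAt
  have hf0 := S.hfpos x (fun h => hx.2 (interior_subset h)) (u x)
  have hdet0 := (hu.2.1 x hx).det_pos
  have hq : HasFDerivAt (fun y => 1 + ∑ i, partialDeriv i u y ^ 2)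
      (∑ i, (2 * partialDeriv i u x) • fderiv ℝ (partialDeriv i u) x) x := by
    refine (HasFDerivAt.fun_sum fun i _ => ?_).const_add 1
    simpa using (hux.hasFDerivAt_partialDeriv i).pow 2
  have hq0 : 0 < 1 + ∑ i, partialDeriv i u x ^ 2 := by positivity
  have hH : HasFDerivAt (fun y => (Matrix.of fun i j => partialDeriv i (partialDeriv j u) y).det)
      (∑ i, ∑ j, (Matrix.of fun i j => partialDeriv i (partialDeriv j u) x).adjugate j i •
        fderiv ℝ (partialDeriv i (partialDeriv j u)) x) x :=
    Matrix.hasFDerivAt_det (H := fun y => Matrix.of fun i j => partialDeriv i (partialDeriv j u) y)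
      fun i j => (hux.partialDeriv j).hasFDerivAt_partialDeriv i
  have hHx : (Matrix.of fun i j => partialDeriv i (partialDeriv j u) x) = Hess u x := by
    ext i j; simp [Hess_apply hux]
  have hlog : (fun y => Real.log (Matrix.of fun i j => partialDeriv i (partialDeriv j u) y).det)
      =ᶠ[𝓝 x] fun y => Real.log (S.f y (u y)) +
        ((n : ℝ) + 2) / 2 * Real.log (1 + ∑ i, partialDeriv i u y ^ 2) := by
    filter_upwards [(isOpen_ball_diff S R).mem_nhds hx] with y hy
    have h1 := hu.2.2.1 y hy
    have h2 : (Matrix.of fun i j => partialDeriv i (partialDeriv j u) y) = Hess u y := by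
      ext i j; simp [Hess_apply (hu.contDiffAt hy)]
    have h3 : 0 < 1 + ∑ i, partialDeriv i u y ^ 2 := by positivity
    have h4 := S.hfpos y (fun h => hy.2 (interior_subset h)) (u y)
    rw [gaussK, norm_fderiv_sq_eq_sum, div_eq_iff (Real.rpow_pos_of_pos h3 _).ne'] at h1
    rw [h2, h1, Real.log_mul h4.ne' (Real.rpow_pos_of_pos h3 _).ne', Real.log_rpow h3]
  rw [hHx] at hH
  have hL := hH.log (by rw [hHx]; exact hdet0.ne')
  have hRr := (hfd.log hf0.ne').add ((hq.log hq0.ne').const_mul (((n : ℝ) + 2) / 2))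
  have heq := hL.unique (hRr.congr_of_eventuallyEq hlog)
  have hk := congrArg (fun ℓ : Euc n →L[ℝ] ℝ => ℓ (EuclideanSpace.single k 1)) heq
  simp only [_root_.add_apply, _root_.smul_apply, _root_.sum_apply, smul_eq_mul, hHx] at hk
  have hsw : ∀ i, fderiv ℝ (partialDeriv i u) x (EuclideanSpace.single k 1) =
      partialDeriv i (partialDeriv k u) x := fun i => partialDeriv_comm hux k i
  have hsw3 : ∀ i j, fderiv ℝ (partialDeriv i (partialDeriv j u)) x (EuclideanSpace.single k 1) =
      partialDeriv i (partialDeriv j (partialDeriv k u)) x := fun i j => by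
    have h1 := partialDeriv_comm (hux.partialDeriv j) k i
    have h2 : partialDeriv k (partialDeriv j u) =ᶠ[𝓝 x] partialDeriv j (partialDeriv k u) := by
      filter_upwards [hev] with y hy using partialDeriv_comm hy k j
    rw [(h2.partialDeriv i).eq_of_nhds] at h1
    exact h1
  simp only [hsw, hsw3] at hk
  have hinv : ∀ i j, (Hess u x)⁻¹ i j = (Hess u x).det⁻¹ * (Hess u x).adjugate i j := fun i j => by
    rw [Matrix.inv_def, Ring.inverse_eq_inv', Matrix.smul_apply, smul_eq_mul]
  have hsymm : ∀ i j, partialDeriv i (partialDeriv j (partialDeriv k u)) x =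
      partialDeriv j (partialDeriv i (partialDeriv k u)) x := fun i j =>
    partialDeriv_comm (hux.partialDeriv k) i j
  have hmain : (∑ i, ∑ j, (Hess u x)⁻¹ i j * partialDeriv i (partialDeriv j (partialDeriv k u)) x) =
      (Hess u x).det⁻¹ * ∑ i, ∑ j, (Hess u x).adjugate j i *
        partialDeriv i (partialDeriv j (partialDeriv k u)) x := by
    rw [Finset.sum_comm, Finset.mul_sum]
    refine Finset.sum_congr rfl fun i _ => ?_
    rw [Finset.mul_sum]
    refine Finset.sum_congr rfl fun j _ => ?_
    rw [hinv, hsymm j i, mul_assoc]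
  rw [linOp, hmain, hk]
  have h2s : ∑ i, 2 * partialDeriv i u x * partialDeriv i (partialDeriv k u) x =
      2 * ∑ i, partialDeriv i u x * partialDeriv i (partialDeriv k u) x := by
    rw [Finset.mul_sum]; exact Finset.sum_congr rfl fun i _ => by ring
  rw [h2s, partialDeriv]
  field_simp
  ring

end

theorem norm_iteratedFDeriv_partialDeriv_le {w : Euc n → ℝ} {x : Euc n} (hw : ContDiffAt ℝ ∞ w x)
    (i : Fin n) (m : ℕ) :
    ‖iteratedFDeriv ℝ m (partialDeriv i w) x‖ ≤ ‖iteratedFDeriv ℝ (m + 1) w x‖ := by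
  have h1 : partialDeriv i w =
      (ContinuousLinearMap.apply ℝ ℝ (EuclideanSpace.single i (1 : ℝ))) ∘ fderiv ℝ w := rfl
  have h2 : ‖ContinuousLinearMap.apply ℝ ℝ (EuclideanSpace.single i (1 : ℝ))‖ ≤ 1 := by
    refine ContinuousLinearMap.opNorm_le_bound _ zero_le_one fun ℓ => ?_
    simpa using ℓ.le_opNorm (EuclideanSpace.single i 1)
  have h3 := ContinuousLinearMap.norm_iteratedFDeriv_comp_left
    (ContinuousLinearMap.apply ℝ ℝ (EuclideanSpace.single i (1 : ℝ)))
    (hw.fderiv_right (m := ∞) (by simp)) (n := m)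
    (by simpa using WithTop.coe_le_coe.2 (le_top : (m : ℕ∞) ≤ ⊤))
  rw [h1, ← norm_iteratedFDeriv_fderiv]
  exact h3.trans (mul_le_of_le_one_left (norm_nonneg _) h2)

theorem abs_partialDeriv_le_iteratedFDeriv (w : Euc n → ℝ) (x : Euc n) (i : Fin n) :
    |partialDeriv i w x| ≤ ‖iteratedFDeriv ℝ 1 w x‖ := by
  rw [norm_iteratedFDeriv_one]
  exact abs_partialDeriv_le w x i

theorem abs_partialDeriv_two_le {w : Euc n → ℝ} {x : Euc n} (hw : ContDiffAt ℝ ∞ w x)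
    (i j : Fin n) : |partialDeriv i (partialDeriv j w) x| ≤ ‖iteratedFDeriv ℝ 2 w x‖ :=
  (abs_partialDeriv_le_iteratedFDeriv _ x i).trans (norm_iteratedFDeriv_partialDeriv_le hw j 1)

theorem abs_partialDeriv_three_le {w : Euc n → ℝ} {x : Euc n} (hw : ContDiffAt ℝ ∞ w x)
    (i j k : Fin n) :
    |partialDeriv i (partialDeriv j (partialDeriv k w)) x| ≤ ‖iteratedFDeriv ℝ 3 w x‖ :=
  (abs_partialDeriv_two_le (hw.partialDeriv k) i j).trans
    (norm_iteratedFDeriv_partialDeriv_le hw k 2)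

theorem partialDeriv_norm {x : Euc n} (hx : x ≠ 0) (j : Fin n) :
    partialDeriv j (fun y => ‖y‖) x = ‖x‖⁻¹ * x j := by
  rw [partialDeriv, (hasFDerivAt_norm hx).fderiv]
  simp [EuclideanSpace.inner_single_right]

theorem abs_apply_le_norm (x : Euc n) (i : Fin n) : |x i| ≤ ‖x‖ := by
  simpa using PiLp.norm_apply_le x i

theorem abs_partialDeriv_two_norm_le {x : Euc n} (hx : x ≠ 0) (i j : Fin n) :
    |partialDeriv i (partialDeriv j fun y => ‖y‖) x| ≤ 2 / ‖x‖ := by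
  have hx0 : 0 < ‖x‖ := norm_pos_iff.2 hx
  have h1 : (partialDeriv j fun y : Euc n => ‖y‖) =ᶠ[𝓝 x] fun y => ‖y‖⁻¹ * y j := by
    filter_upwards [isOpen_ne.mem_nhds hx] with y hy using partialDeriv_norm hy j
  have h2 : HasFDerivAt (fun y : Euc n => ‖y‖⁻¹) (-((‖x‖ ^ 2)⁻¹) • (‖x‖⁻¹ • innerSL ℝ x)) x :=
    (hasDerivAt_inv hx0.ne').comp_hasFDerivAt x (hasFDerivAt_norm hx)
  have h3 := h2.mul ((EuclideanSpace.proj j : Euc n →L[ℝ] ℝ).hasFDerivAt (x := x))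
  have h4 : partialDeriv i (fun y : Euc n => ‖y‖⁻¹ * y j) x =
      ‖x‖⁻¹ * (EuclideanSpace.single i (1 : ℝ) : Euc n) j - x j * x i / ‖x‖ ^ 3 := by
    rw [partialDeriv]
    have h5 := h3.fderiv
    have h6 : ((fun y : Euc n => ‖y‖⁻¹) * (EuclideanSpace.proj j : Euc n →L[ℝ] ℝ)) =
      fun y : Euc n => ‖y‖⁻¹ * y j := rfl
    rw [h6] at h5
    rw [h5]
    have hp : ∀ z : Euc n, (EuclideanSpace.proj j : Euc n →L[ℝ] ℝ) z = z j := fun _ => rfl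
    simp only [_root_.add_apply, _root_.smul_apply, smul_eq_mul, innerSL_apply_apply,
      hp, EuclideanSpace.inner_single_right, conj_trivial]
    ring
  rw [(h1.partialDeriv i).eq_of_nhds, h4]
  have h5 : |(EuclideanSpace.single i (1 : ℝ) : Euc n) j| ≤ 1 := by
    simpa using abs_apply_le_norm (EuclideanSpace.single i (1 : ℝ)) j
  have h6 : |x j * x i / ‖x‖ ^ 3| ≤ 1 / ‖x‖ := by
    rw [abs_div, abs_mul, abs_of_pos (pow_pos hx0 3), div_le_div_iff₀ (by positivity) hx0]
    have := mul_le_mul (abs_apply_le_norm x j) (abs_apply_le_norm x i) (abs_nonneg _) hx0.le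
    nlinarith
  calc _ ≤ |‖x‖⁻¹ * (EuclideanSpace.single i (1 : ℝ) : Euc n) j| + |x j * x i / ‖x‖ ^ 3| :=
        abs_sub _ _
    _ ≤ ‖x‖⁻¹ * 1 + 1 / ‖x‖ := by
        rw [abs_mul, abs_of_pos (inv_pos.2 hx0)]
        gcongr
    _ = 2 / ‖x‖ := by ring

theorem abs_first_order_le {p q : Fin n → ℝ} {c : ℝ} (hq : ∀ i, |q i| ≤ c) :
    |((n : ℝ) + 2) / (1 + ∑ i, p i ^ 2) * ∑ i, p i * q i| ≤ ((n : ℝ) + 2) * (n * c) := by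
  have h0 : 0 < 1 + ∑ i, p i ^ 2 := by positivity
  have h1 : |∑ i, p i * q i| ≤ (1 + ∑ i, p i ^ 2) * (n * c) := by
    calc _ ≤ ∑ i, |p i * q i| := Finset.abs_sum_le_sum_abs _ _
      _ ≤ ∑ _i : Fin n, (1 + ∑ i, p i ^ 2) * c := by
          refine Finset.sum_le_sum fun i _ => ?_
          rw [abs_mul]
          have h2 : |p i| ≤ 1 + p i ^ 2 := by nlinarith [sq_nonneg (|p i| - 1), sq_abs (p i)]
          have h3 : p i ^ 2 ≤ ∑ i, p i ^ 2 :=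
            Finset.single_le_sum (f := fun i => p i ^ 2) (fun j _ => sq_nonneg _)
              (Finset.mem_univ i)
          exact mul_le_mul (by linarith) (hq i) (abs_nonneg _) h0.le
      _ = _ := by simp; ring
  rw [abs_mul, abs_of_nonneg (by positivity), div_mul_eq_mul_div, div_le_iff₀ h0]
  have : (0 : ℝ) ≤ n + 2 := by positivity
  nlinarith [mul_le_mul_of_nonneg_left h1 this]

theorem abs_linOp_le {u w : Euc n → ℝ} {x : Euc n} (hH : (Hess u x).PosDef) {a c : ℝ}
    (h1 : ∀ i, |partialDeriv i w x| ≤ c)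
    (h2 : ∀ i j, |partialDeriv i (partialDeriv j w) x| ≤ a) :
    |linOp u w x| ≤ (n : ℝ) ^ 2 * a * (Hess u x)⁻¹.trace + ((n : ℝ) + 2) * (n * c) := by
  refine (abs_sub _ _).trans (add_le_add ?_ (abs_first_order_le h1))
  have htr := hH.inv.posSemidef.trace_nonneg
  calc _ ≤ ∑ i, ∑ j, |(Hess u x)⁻¹ i j * partialDeriv i (partialDeriv j w) x| :=
        (Finset.abs_sum_le_sum_abs _ _).trans
          (Finset.sum_le_sum fun i _ => Finset.abs_sum_le_sum_abs _ _)
    _ ≤ ∑ _i : Fin n, ∑ _j : Fin n, (Hess u x)⁻¹.trace * a := by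
        refine Finset.sum_le_sum fun i _ => Finset.sum_le_sum fun j _ => ?_
        rw [abs_mul]
        exact mul_le_mul (hH.inv.posSemidef.abs_apply_le_trace i j) (h2 i j) (abs_nonneg _) htr
    _ = _ := by simp; ring

theorem linOp_tangOp {u v : Euc n → ℝ} {x : Euc n} (R : ℝ) (t last : Fin n)
    (hv : ∀ᶠ y in 𝓝 x, ContDiffAt ℝ ∞ v y) :
    linOp u (tangOp R t last v) x =
      linOp u (partialDeriv t v) x - linOp u (fun y => y t / R * partialDeriv last v y) x := by
  have h1 : ∀ᶠ y in 𝓝 x, ContDiffAt ℝ ∞ (fun y => y t / R * partialDeriv last v y) y := by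
    filter_upwards [hv] with y hy
    exact (contDiff_coord_div R t).contDiffAt.mul (hy.partialDeriv last)
  have h2 : ∀ᶠ y in 𝓝 x, ContDiffAt ℝ ∞ (partialDeriv t v) y := by
    filter_upwards [hv] with y hy using hy.partialDeriv t
  exact linOp_sub u h2 h1

theorem contDiffAt_tangOp {v : Euc n → ℝ} {x : Euc n} (R : ℝ) (t last : Fin n)
    (hv : ContDiffAt ℝ ∞ v x) : ContDiffAt ℝ ∞ (tangOp R t last v) x :=
  (hv.partialDeriv t).sub ((contDiff_coord_div R t).contDiffAt.mul (hv.partialDeriv last))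

theorem ExtSetting.exists_linOp_tangOp_bound (S : ExtSetting n) {t last : Fin n} (htl : t ≠ last) :
    ∃ c : ℝ, 0 ≤ c ∧ ∀ R : ℝ, 4 * S.R₀ < R → ∀ u : Euc n → ℝ, IsSol S R u →
      ∀ x : Euc n, R / 2 ≤ ‖x‖ → ‖x‖ < R → |linOp u (tangOp R t last u) x| ≤ c := by
  obtain ⟨A, hA, hgrad⟩ := S.exists_gradient_sub_bound
  obtain ⟨C, hC0, hC⟩ := S.exists_rhs_bound
  have hR₀ := S.hR₀
  refine ⟨2 * (C * (1 + A)) + ((n : ℝ) + 2) / S.R₀, by positivity, fun R hR u hu x h1 h2 => ?_⟩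
  have hRp : 0 < R := by linarith
  have hx : x ∈ ball 0 R \ S.K := mem_ball_diff_of_le_norm S (by linarith) h2
  have hux := hu.contDiffAt hx
  have hev := hu.eventually_contDiffAt hx
  have hDu := (hgrad R hR u hu x h1 h2).2
  have hF : ∀ k, |linOp u (partialDeriv k u) x| ≤ C * (1 + A) := fun k => by
    have hf0 := S.hfpos x (fun h => hx.2 (interior_subset h)) (u x)
    rw [hu.linOp_partialDeriv hx, abs_div, abs_of_pos hf0, div_le_iff₀ hf0]
    refine ((hC u x hx.2 hux).2 k).trans ?_
    gcongr
  have hunit : IsUnit (Hess u x).det := (hu.2.1 x hx).det_pos.ne'.isUnit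
  have hz1 : ∑ j, (Hess u x)⁻¹ t j * partialDeriv j (partialDeriv last u) x = 0 := by
    have h3 := congrFun (congrFun (Matrix.nonsing_inv_mul _ hunit) t) last
    rw [Matrix.mul_apply, Matrix.one_apply_ne htl] at h3
    simpa only [Hess_apply hux] using h3
  have hz2 : ∑ i, (Hess u x)⁻¹ i t * partialDeriv i (partialDeriv last u) x = 0 := by
    have h3 := congrFun (congrFun (Matrix.mul_nonsing_inv _ hunit) last) t
    rw [Matrix.mul_apply, Matrix.one_apply_ne htl.symm] at h3
    rw [← h3]
    refine Finset.sum_congr rfl fun i _ => ?_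
    rw [Hess_apply hux, partialDeriv_comm hux, mul_comm]
  have hevl : ∀ᶠ y in 𝓝 x, ContDiffAt ℝ ∞ (partialDeriv last u) y := by
    filter_upwards [hev] with y hy using hy.partialDeriv last
  rw [linOp_tangOp R t last hev, linOp_coord_mul u hevl, hz1, hz2, zero_div, add_zero, add_zero]
  have h5 := abs_apply_div_le_one hRp h2.le t
  have hlow : |((n : ℝ) + 2) / (1 + ∑ i, partialDeriv i u x ^ 2) *
      (partialDeriv t u x * partialDeriv last u x / R)| ≤ ((n : ℝ) + 2) / S.R₀ := by
    have h6 : |partialDeriv t u x * partialDeriv last u x| ≤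
        1 + ∑ i, partialDeriv i u x ^ 2 := by
      rw [← norm_fderiv_sq_eq_sum, abs_mul]
      have := mul_le_mul (abs_partialDeriv_le u x t) (abs_partialDeriv_le u x last) (abs_nonneg _)
        (norm_nonneg _)
      nlinarith
    have h7 : 0 < 1 + ∑ i, partialDeriv i u x ^ 2 := by positivity
    rw [abs_mul, abs_div, abs_div _ R, abs_of_pos h7, abs_of_pos hRp,
      abs_of_pos (show (0 : ℝ) < n + 2 by positivity), div_mul_div_comm]
    rw [div_le_div_iff₀ (by positivity) hR₀]
    have h8 : S.R₀ ≤ R := by linarith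
    calc _ ≤ ((n : ℝ) + 2) * (1 + ∑ i, partialDeriv i u x ^ 2) * R := by gcongr
      _ = _ := by ring
  have hxt : |x t / R * linOp u (partialDeriv last u) x| ≤ 1 * (C * (1 + A)) := by
    rw [abs_mul]
    exact mul_le_mul h5 (hF last) (abs_nonneg _) zero_le_one
  have ha := abs_le.1 (hF t)
  have hb := abs_le.1 hxt
  have hc := abs_le.1 hlow
  rw [abs_le]
  constructor <;> linarith [ha.1, ha.2, hb.1, hb.2, hc.1, hc.2]

theorem ExtSetting.exists_tangOp_ul_bound (S : ExtSetting n) (t last : Fin n) :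
    ∃ c : ℝ, 0 ≤ c ∧ ∀ R : ℝ, 4 * S.R₀ < R → ∀ x : Euc n, R / 2 ≤ ‖x‖ → ‖x‖ < R →
      (∀ i, |partialDeriv i (tangOp R t last S.ul) x| ≤ c) ∧
      ∀ i j, |partialDeriv i (partialDeriv j (tangOp R t last S.ul)) x| ≤ c / R ^ 2 := by
  obtain ⟨C, hC0, -, hC1, hC2⟩ := S.exists_cone_bounds
  have hR₀ := S.hR₀
  set B := 4 + C / S.R₀ with hB
  have hBp : 0 < B := by positivity
  refine ⟨max (2 * B / S.R₀ + (1 + C / S.R₀) / S.R₀) (8 * C + 2 * B), by positivity,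
    fun R hR x h1 h2 => ?_⟩
  have hRp : 0 < R := by linarith
  have hxR : S.R₀ ≤ ‖x‖ := by linarith
  have hx0 := S.ne_zero_of_le_norm hxR
  have hxn : 0 < ‖x‖ := norm_pos_iff.2 hx0
  have hxK := S.notMem_of_le_norm hxR
  have hux := S.contDiffAt_ul hxK
  have hev := S.eventually_contDiffAt_ul hxK
  have hevn : ∀ᶠ y in 𝓝 x, ContDiffAt ℝ ∞ (fun y : Euc n => ‖y‖) y := by
    filter_upwards [isOpen_ne.mem_nhds hx0] with y hy using contDiffAt_norm_infty hy
  have hψ := S.contDiffAt_ul_sub_norm hxR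
  have hsq : C / ‖x‖ ^ 2 ≤ 4 * C / R ^ 2 := by
    rw [div_le_div_iff₀ (by positivity) (by positivity)]
    have : R ^ 2 ≤ 4 * ‖x‖ ^ 2 := by nlinarith
    nlinarith
  have hinv : 2 / ‖x‖ ≤ 4 / R := by
    rw [div_le_div_iff₀ hxn hRp]; linarith
  have hsq2 : 4 * C / R ^ 2 ≤ C / S.R₀ / R := by
    rw [div_div, div_le_div_iff₀ (by positivity) (by positivity)]
    nlinarith [mul_pos hC0 hRp]
  have hthree : ∀ i j k, |partialDeriv i (partialDeriv j (partialDeriv k S.ul)) x| ≤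
      4 * C / R ^ 2 := fun i j k => by
    have := hC2 x hxR
    have h3 := norm_nonneg (iteratedFDeriv ℝ 2 (fun y => S.ul y - ‖y‖) x)
    linarith [abs_partialDeriv_three_le hux i j k]
  have htwo : ∀ i j, |partialDeriv i (partialDeriv j S.ul) x| ≤ B / R := fun i j => by
    have h3 := hC2 x hxR
    have h4 := norm_nonneg (iteratedFDeriv ℝ 3 S.ul x)
    have h5 := abs_partialDeriv_two_le hψ i j
    have h6 := abs_partialDeriv_two_norm_le hx0 i j
    have h7 : partialDeriv i (partialDeriv j fun y => S.ul y - ‖y‖) x =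
        partialDeriv i (partialDeriv j S.ul) x - partialDeriv i (partialDeriv j fun y => ‖y‖) x :=
      partialDeriv_partialDeriv_sub hev hevn i j
    rw [h7] at h5
    have h8 : B / R = 4 / R + C / S.R₀ / R := by rw [hB]; ring
    have h9 := abs_sub_abs_le_abs_sub (partialDeriv i (partialDeriv j S.ul) x)
      (partialDeriv i (partialDeriv j fun y => ‖y‖) x)
    rw [h8]
    linarith
  have hone : ∀ i, |partialDeriv i S.ul x| ≤ 1 + C / S.R₀ := fun i => by
    refine (abs_partialDeriv_le _ _ i).trans ?_
    have h3 := hC1 x hxR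
    rw [← S.norm_fderiv_ul_sub_le hxR] at h3
    have h4 : ‖‖x‖⁻¹ • innerSL ℝ x‖ = 1 := by
      rw [norm_smul, innerSL_apply_norm, norm_inv, norm_norm, inv_mul_cancel₀ hxn.ne']
    have h5 := norm_le_insert' (fderiv ℝ S.ul x) (‖x‖⁻¹ • innerSL ℝ x)
    have h6 : C / ‖x‖ ≤ C / S.R₀ := by gcongr
    linarith
  have ht := abs_apply_div_le_one hRp h2.le t
  have hdl : DifferentiableAt ℝ (partialDeriv last S.ul) x :=
    (hux.partialDeriv last).differentiableAt (by simp)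
  have hevl : ∀ᶠ y in 𝓝 x, ContDiffAt ℝ ∞ (partialDeriv last S.ul) y := by
    filter_upwards [hev] with y hy using hy.partialDeriv last
  have hevt : ∀ᶠ y in 𝓝 x, ContDiffAt ℝ ∞ (partialDeriv t S.ul) y := by
    filter_upwards [hev] with y hy using hy.partialDeriv t
  have hevm : ∀ᶠ y in 𝓝 x, ContDiffAt ℝ ∞ (fun y => y t / R * partialDeriv last S.ul y) y := by
    filter_upwards [hevl] with y hy using (contDiff_coord_div R t).contDiffAt.mul hy
  have hmulc : ContDiffAt ℝ ∞ (fun y => y t / R * partialDeriv last S.ul y) x :=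
    (contDiff_coord_div R t).contDiffAt.mul (hux.partialDeriv last)
  constructor
  · intro i
    have h3 : partialDeriv i (tangOp R t last S.ul) x = partialDeriv i (partialDeriv t S.ul) x -
        (x t / R * partialDeriv i (partialDeriv last S.ul) x +
          if i = t then partialDeriv last S.ul x / R else 0) := by
      rw [← partialDeriv_coord_mul hdl]
      exact partialDeriv_sub ((hux.partialDeriv t).differentiableAt (by simp))
        (hmulc.differentiableAt (by simp)) i
    have h4 : |x t / R * partialDeriv i (partialDeriv last S.ul) x| ≤ 1 * (B / R) := by
      rw [abs_mul]
      exact mul_le_mul ht (htwo i last) (abs_nonneg _) zero_le_one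
    have h5 : |if i = t then partialDeriv last S.ul x / R else 0| ≤ (1 + C / S.R₀) / S.R₀ := by
      split_ifs
      · rw [abs_div, abs_of_pos hRp]
        have h8 : S.R₀ ≤ R := by linarith
        have := hone last
        gcongr
      · rw [abs_zero]; positivity
    have h6 : B / R ≤ B / S.R₀ := by gcongr; linarith
    have h7 : 2 * B / S.R₀ = B / S.R₀ + B / S.R₀ := by ring
    refine le_max_of_le_left ?_
    rw [h3, abs_le]
    have h8 := abs_le.1 h4
    have h9 := abs_le.1 h5
    have h10 := abs_le.1 (htwo i t)
    constructor <;> linarith [h8.1, h8.2, h9.1, h9.2, h10.1, h10.2]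
  · intro i j
    have h3 : partialDeriv i (partialDeriv j (tangOp R t last S.ul)) x =
        partialDeriv i (partialDeriv j (partialDeriv t S.ul)) x -
        (x t / R * partialDeriv i (partialDeriv j (partialDeriv last S.ul)) x +
          (if i = t then partialDeriv j (partialDeriv last S.ul) x / R else 0) +
          if j = t then partialDeriv i (partialDeriv last S.ul) x / R else 0) := by
      rw [← partialDeriv_partialDeriv_coord_mul hevl]
      exact partialDeriv_partialDeriv_sub hevt hevm i j
    have h4 : |x t / R * partialDeriv i (partialDeriv j (partialDeriv last S.ul)) x| ≤
        1 * (4 * C / R ^ 2) := by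
      rw [abs_mul]
      exact mul_le_mul ht (hthree i j last) (abs_nonneg _) zero_le_one
    have h5 : ∀ (p : Prop) [Decidable p] (k : Fin n),
        |if p then partialDeriv k (partialDeriv last S.ul) x / R else 0| ≤ B / R ^ 2 := by
      intro p _ k
      split_ifs
      · rw [abs_div, abs_of_pos hRp, pow_two, ← div_div]
        have := htwo k last
        gcongr
      · rw [abs_zero]; positivity
    have h6 : max (2 * B / S.R₀ + (1 + C / S.R₀) / S.R₀) (8 * C + 2 * B) / R ^ 2 ≥
        (8 * C + 2 * B) / R ^ 2 := by
      gcongr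
      exact le_max_right _ _
    have h7 : (8 * C + 2 * B) / R ^ 2 = 4 * C / R ^ 2 + 4 * C / R ^ 2 + B / R ^ 2 + B / R ^ 2 := by
      ring
    refine le_trans ?_ h6
    rw [h3, abs_le, h7]
    have h8 := abs_le.1 h4
    have h9 := abs_le.1 (h5 (i = t) j)
    have h10 := abs_le.1 (h5 (j = t) i)
    have h11 := abs_le.1 (hthree i j t)
    constructor <;> linarith [h8.1, h8.2, h9.1, h9.2, h10.1, h10.2, h11.1, h11.2]

theorem HessW_solDom {S : ExtSetting n} {R : ℝ} (w : Euc n → ℝ) {x : Euc n}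
    (hx : x ∈ ball (0 : Euc n) R \ S.K) : HessW (solDom S R) w x = Hess w x := by
  have h := iteratedFDerivWithin_congr_set (𝕜 := ℝ) (f := w)
    (eventuallyEq_univ.2 (solDom_mem_nhds S hx)) 2
  ext i j
  rw [HessW, Hess, h, iteratedFDerivWithin_univ]

theorem Tlin_sub_eventuallyEq {S : ExtSetting n} {R : ℝ} {u : Euc n → ℝ} (hu : IsSol S R u)
    (t last : Fin n) {x : Euc n} (hx : x ∈ ball (0 : Euc n) R \ S.K) :
    Tlin (solDom S R) R t last (fun y => u y - S.ul y) =ᶠ[𝓝 x]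
      fun y => tangOp R t last u y - tangOp R t last S.ul y := by
  filter_upwards [(isOpen_ball_diff S R).mem_nhds hx] with y hy
  have h1 := (hu.contDiffAt hy).differentiableAt (by simp)
  have h2 := (S.contDiffAt_ul hy.2).differentiableAt (by simp)
  rw [Tlin_solDom _ _ _ hy, partialDeriv_sub h1 h2, partialDeriv_sub h1 h2, tangOp, tangOp]
  ring

theorem Llin_solDom {S : ExtSetting n} {R : ℝ} (u : Euc n → ℝ) {w : Euc n → ℝ} {x : Euc n}
    (hx : x ∈ ball (0 : Euc n) R \ S.K) (hw : ContDiffAt ℝ ∞ w x) :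
    Llin (solDom S R) u w x = linOp u w x := by
  simp only [Llin, linOp, HessW_solDom _ hx, pdW_solDom _ hx, Hess_apply hw]

theorem ExtSetting.exists_Llin_bound (S : ExtSetting n) {t last : Fin n} (htl : t ≠ last) :
    ∃ c : ℝ, 0 < c ∧ ∀ R : ℝ, 4 * S.R₀ < R → ∀ u : Euc n → ℝ, IsSol S R u →
      ∀ x : Euc n, R / 2 ≤ ‖x‖ → ‖x‖ < R →
        |Llin (solDom S R) u (Tlin (solDom S R) R t last (fun y => u y - S.ul y)) x|
          ≤ c + c / R ^ 2 * Matrix.trace (HessW (solDom S R) u x)⁻¹ := by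
  obtain ⟨c₁, hc₁, h₁⟩ := S.exists_linOp_tangOp_bound htl
  obtain ⟨c₂, hc₂, h₂⟩ := S.exists_tangOp_ul_bound t last
  refine ⟨c₁ + ((n : ℝ) + 2) * (n * c₂) + (n : ℝ) ^ 2 * c₂ + 1, by positivity, ?_⟩
  intro R hR u hu x hx1 hx2
  have hx : x ∈ ball (0 : Euc n) R \ S.K :=
    mem_ball_diff_of_le_norm S (by linarith [S.hR₀]) hx2
  have hH : (Hess u x).PosDef := hu.2.1 x hx
  have htr : 0 ≤ (Hess u x)⁻¹.trace := hH.inv.posSemidef.trace_nonneg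
  have hev := Tlin_sub_eventuallyEq hu t last hx
  have hTu : ∀ᶠ y in 𝓝 x, ContDiffAt ℝ ∞ (tangOp R t last u) y :=
    (hu.eventually_contDiffAt hx).mono fun y hy => contDiffAt_tangOp R t last hy
  have hTul : ∀ᶠ y in 𝓝 x, ContDiffAt ℝ ∞ (tangOp R t last S.ul) y :=
    (S.eventually_contDiffAt_ul hx.2).mono fun y hy => contDiffAt_tangOp R t last hy
  rw [Llin_solDom u hx ((hTu.self_of_nhds.sub hTul.self_of_nhds).congr_of_eventuallyEq hev),
    linOp_congr u hev, linOp_sub u hTu hTul, HessW_solDom u hx]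
  obtain ⟨ha, hb⟩ := h₂ R hR x hx1 hx2
  have hR2 : 0 < R ^ 2 := pow_pos (by linarith [S.hR₀]) 2
  calc _ ≤ |linOp u (tangOp R t last u) x| + |linOp u (tangOp R t last S.ul) x| := abs_sub _ _
    _ ≤ c₁ + ((n : ℝ) ^ 2 * (c₂ / R ^ 2) * (Hess u x)⁻¹.trace + ((n : ℝ) + 2) * (n * c₂)) :=
        add_le_add (h₁ R hR u hu x hx1 hx2) (abs_linOp_le hH ha hb)
    _ = (c₁ + ((n : ℝ) + 2) * (n * c₂)) + (n : ℝ) ^ 2 * c₂ / R ^ 2 * (Hess u x)⁻¹.trace := by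
        ring
    _ ≤ _ := by
        have h3 : 0 ≤ ((n : ℝ) + 2) * (n * c₂) := by positivity
        have h4 : 0 ≤ (n : ℝ) ^ 2 * c₂ := by positivity
        refine add_le_add (by linarith) (mul_le_mul_of_nonneg_right ?_ htr)
        exact div_le_div_of_nonneg_right (by linarith) hR2.le

end

theorem T_estimates
    (n : ℕ) (S : ExtSetting n) (t last : Fin n)
    (ht : (t : ℕ) < n - 1) (hlast : (last : ℕ) = n - 1) :
    ∃ c : ℝ, ∀ R : ℝ, 4 * S.R₀ < R → ∀ u : Euc n → ℝ, IsSol S R u →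
      ∀ δ : ℝ, 0 < δ → δ ≤ R / 2 →
        (∀ x ∈ ball (EuclideanSpace.single last R) δ ∩ ball (0 : Euc n) R,
          |Tlin (solDom S R) R t last (fun y => u y - S.ul y) x| ≤ c / Real.sqrt R) ∧
        (∀ x ∈ sphere (0 : Euc n) R,
          |Tlin (solDom S R) R t last (fun y => u y - S.ul y) x|
            ≤ c / R ^ 2 * ‖x - EuclideanSpace.single last R‖ ^ 2) ∧
        (∀ x ∈ ball (EuclideanSpace.single last R) δ ∩ ball (0 : Euc n) R,
          |Llin (solDom S R) u (Tlin (solDom S R) R t last (fun y => u y - S.ul y)) x|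
            ≤ c + c / R ^ 2 * Matrix.trace (HessW (solDom S R) u x)⁻¹) := by
  have htl : t ≠ last := by
    rintro rfl
    omega
  obtain ⟨c₁, hc₁, h₁⟩ := S.exists_Tlin_interior_bound t last
  obtain ⟨c₂, hc₂, h₂⟩ := S.exists_Tlin_sphere_bound t last
  obtain ⟨c₃, hc₃, h₃⟩ := S.exists_Llin_bound htl
  refine ⟨c₁ + c₂ + c₃, fun R hR u hu δ _ hδ => ⟨fun x hx => ?_, fun x hx => ?_, fun x hx => ?_⟩⟩
  all_goals have hR0 : 0 < R := by linarith [S.hR₀]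
  · refine (h₁ R hR u hu x (half_le_norm_of_mem_ball hR0 hδ hx.1)
      (mem_ball_zero_iff.1 hx.2)).trans ?_
    gcongr
    linarith
  · refine (h₂ R hR u hu x hx).trans ?_
    gcongr
    linarith
  · have hx1 := half_le_norm_of_mem_ball hR0 hδ hx.1
    have hx2 := mem_ball_zero_iff.1 hx.2
    have hxm : x ∈ ball (0 : Euc n) R \ S.K :=
      mem_ball_diff_of_le_norm S (by linarith [S.hR₀]) hx2
    have htr : 0 ≤ (HessW (solDom S R) u x)⁻¹.trace := by
      rw [HessW_solDom u hxm]
      exact (hu.2.1 x hxm).inv.posSemidef.trace_nonneg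
    refine (h₃ R hR u hu x hx1 hx2).trans ?_
    gcongr
    · linarith
    · linarith
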